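/- arXiv:1601.04555 — 10 statements merged into one kernel-verified Lean document; each statement's English description precedes it below -/
import Mathlib

section
/- For every d₁ ∈ D there exists d₂ ∈ D with d₁ ≺ d₂ such that D splits between d₁ and d₂. -/
open Set

/-- `D` splits between `d₁` and `d₂` with respect to the order `prec` (`≺`):
for all `e₁ < e₂` in `D` with `e₁ ⪯ d₁` and `e₂ ⪯ d₁` there is `e₃ ∈ D` with
`d₁ ≺ e₃ ≺ d₂` and `e₁ < e₃ < e₂`. -/
def SplitsBetween (D : Set ℝ) (prec : ℝ → ℝ → Prop) (d₁ d₂ : ℝ) : Prop :=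
  ∀ e₁ ∈ D, ∀ e₂ ∈ D, e₁ < e₂ → (prec e₁ d₁ ∨ e₁ = d₁) → (prec e₂ d₁ ∨ e₂ = d₁) →
    ∃ e₃ ∈ D, prec d₁ e₃ ∧ prec e₃ d₂ ∧ e₁ < e₃ ∧ e₃ < e₂

/-- A set that is dense in an interval has a point in any nonempty open subinterval outside a
given finite set. -/
theorem exists_mem_Ioo_notMem_of_finite {D : Set ℝ} {a b : ℝ} (hab : a < b)
    (hdense : Ioo a b ⊆ closure D) {F : Set ℝ} (hF : F.Finite) :
    ∃ x ∈ D, x ∉ F ∧ a < x ∧ x < b := by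
  obtain ⟨y, hy, hyF⟩ := ((Ioo_infinite hab).sdiff hF).nonempty
  obtain ⟨x, ⟨hx, hxF⟩, hxD⟩ := mem_closure_iff.1 (hdense hy) (Ioo a b \ F)
    (isOpen_Ioo.sdiff hF.isClosed) ⟨hy, hyF⟩
  exact ⟨x, hxD, hxF, hx.1, hx.2⟩

theorem stmt0 (D : Set ℝ) (prec : ℝ → ℝ → Prop)
    (hD : D ⊆ Icc (0:ℝ) 1)
    (hdense : ∀ x ∈ Icc (0:ℝ) 1, x ∈ closure D)
    (h0 : (0:ℝ) ∈ D) (h1 : (1:ℝ) ∈ D)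
    (hirr : ∀ d ∈ D, ¬ prec d d)
    (htrans : ∀ a ∈ D, ∀ b ∈ D, ∀ c ∈ D, prec a b → prec b c → prec a c)
    (htri : ∀ a ∈ D, ∀ b ∈ D, a ≠ b → prec a b ∨ prec b a)
    (hfin : ∀ d ∈ D, {e ∈ D | prec e d}.Finite)
    (hmin : ∀ d ∈ D, d ≠ 1 → prec 1 d)
    (hsucc : prec 1 0 ∧ ∀ d ∈ D, prec 1 d → d = 0 ∨ prec 0 d) :
    ∀ d₁ ∈ D, ∃ d₂ ∈ D, prec d₁ d₂ ∧ SplitsBetween D prec d₁ d₂ := by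
  have hpick : ∀ e₁ ∈ D, ∀ e₂ ∈ D, e₁ < e₂ → ∀ F : Set ℝ, F.Finite →
      ∃ x ∈ D, x ∉ F ∧ e₁ < x ∧ x < e₂ := fun e₁ he₁ e₂ he₂ hlt F hF ↦
    exists_mem_Ioo_notMem_of_finite hlt
      (fun x hx ↦ hdense x ⟨(hD he₁).1.trans hx.1.le, hx.2.le.trans (hD he₂).2⟩) hF
  have hseg : ∀ d ∈ D, {e ∈ D | prec e d ∨ e = d}.Finite := fun d hd ↦
    ((hfin d hd).union (finite_singleton d)).subset fun e he ↦
      he.2.imp (fun h ↦ ⟨he.1, h⟩) id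
  have hbound : ∀ T : Set ℝ, T.Finite → T ⊆ D → ∃ d ∈ D, ∀ t ∈ T, prec t d := by
    intro T hT hTD
    obtain ⟨d, hd, hdT, -⟩ := hpick 0 h0 1 h1 one_pos _
      (hT.biUnion fun t ht ↦ hseg t (hTD ht))
    refine ⟨d, hd, fun t ht ↦ ?_⟩
    have hnot : ¬ (prec d t ∨ d = t) := fun h ↦ hdT (mem_biUnion ht ⟨hd, h⟩)
    rw [not_or] at hnot
    exact (htri t (hTD ht) d hd (Ne.symm hnot.2)).resolve_right hnot.1
  intro d₁ hd₁
  set S := {e ∈ D | prec e d₁ ∨ e = d₁}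
  have hSfin : S.Finite := hseg d₁ hd₁
  have hmid : ∀ p : ℝ × ℝ, ∃ x ∈ D, p.1 ∈ S → p.2 ∈ S → p.1 < p.2 →
      x ∉ S ∧ p.1 < x ∧ x < p.2 := by
    intro p
    by_cases h : p.1 ∈ S ∧ p.2 ∈ S ∧ p.1 < p.2
    · obtain ⟨x, hx, hx'⟩ := hpick p.1 h.1.1 p.2 h.2.1.1 h.2.2 S hSfin
      exact ⟨x, hx, fun _ _ _ ↦ hx'⟩
    · exact ⟨0, h0, fun h₁ h₂ h₃ ↦ absurd ⟨h₁, h₂, h₃⟩ h⟩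
  choose f hfD hf using hmid
  obtain ⟨d₂, hd₂, hub⟩ := hbound (insert d₁ (f '' (S ×ˢ S)))
    (((hSfin.prod hSfin).image f).insert d₁)
    (insert_subset hd₁ (image_subset_iff.2 fun p _ ↦ hfD p))
  refine ⟨d₂, hd₂, hub d₁ (mem_insert _ _), fun e₁ he₁ e₂ he₂ hlt h₁ h₂ ↦ ?_⟩
  obtain ⟨hnS, hl, hr⟩ := hf (e₁, e₂) ⟨he₁, h₁⟩ ⟨he₂, h₂⟩ hlt
  have hnot : ¬ (prec (f (e₁, e₂)) d₁ ∨ f (e₁, e₂) = d₁) := fun h ↦ hnS ⟨hfD _, h⟩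
  rw [not_or] at hnot
  exact ⟨f (e₁, e₂), hfD _, (htri d₁ hd₁ _ (hfD _) (Ne.symm hnot.2)).resolve_right hnot.1,
    hub _ (mem_insert_of_mem _ (mem_image_of_mem f ⟨⟨he₁, h₁⟩, ⟨he₂, h₂⟩⟩)), hl, hr⟩
end

section
/- There exist a sequence e : ℕ → D and a real number a ∈ [0,1] such that: e₀ = 0; eₙ ≺ eₙ₊₁ and eₙ ≤ eₙ₊₁ for all n; D splits between eₘ and eₙ whenever m < n (so {eₙ : n ∈ ℕ} is a splitting set, i.e., an infinite subset of D such that D splits between any two of its elements); and Lₐ = {eₙ : n ∈ ℕ}. -/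
open Set

/-- `L_c`: the set of best approximations of `c` from the left, i.e. the set of all
`l(c,d)` for `d ∈ D` with `0 ⪯ d`, where `l(c,d)` is the greatest element of
`{e ∈ D : e ⪯ d, e ≤ c}`. -/
def LeftApproxSet (D : Set ℝ) (prec : ℝ → ℝ → Prop) (c : ℝ) : Set ℝ :=
  {x | ∃ d ∈ D, (prec 0 d ∨ d = 0) ∧
    IsGreatest {e ∈ D | (prec e d ∨ e = d) ∧ e ≤ c} x}

open Filter Topology

/-- To the right of `x` there is a gap avoiding the elements of rank at most `N`. -/
lemma exists_gap_right {D : Set ℝ} {r : ℝ → ℕ} (hr : InjOn r D) (x : ℝ) (N : ℕ) :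
    ∃ c, x < c ∧ ∀ e ∈ D, r e ≤ N → x < e → c < e := by
  have hfin : {e ∈ D | r e ≤ N}.Finite :=
    Set.Finite.of_finite_image ((finite_Iic N).subset (by rintro _ ⟨e, he, rfl⟩; exact he.2))
      (hr.mono fun e he => he.1)
  have h : ∀ᶠ c in 𝓝[>] x, ∀ e ∈ {e ∈ D | r e ≤ N}, x < e → c < e := by
    rw [eventually_all_finite hfin]
    intro e _
    by_cases hx : x < e
    · filter_upwards [Ioo_mem_nhdsGT hx] with c hc _ using hc.2
    · exact Eventually.of_forall fun c h => absurd h hx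
  obtain ⟨c, hc, hxc⟩ := (h.and self_mem_nhdsWithin).exists
  exact ⟨c, hxc, fun e he hN => hc e ⟨he, hN⟩⟩

/-- A set dense in `[0, 1]` meets every interval in elements of arbitrarily large rank. -/
lemma exists_between_rank_gt {D : Set ℝ} {r : ℝ → ℕ} (hr : InjOn r D)
    (hdense : ∀ u v, 0 ≤ u → u < v → v ≤ 1 → ∃ z ∈ D, u < z ∧ z < v)
    (N : ℕ) {u v : ℝ} (hu : 0 ≤ u) (huv : u < v) (hv : v ≤ 1) :
    ∃ z ∈ D, u < z ∧ z < v ∧ N < r z := by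
  obtain ⟨c, huc, hc⟩ := exists_gap_right hr u N
  obtain ⟨z, hz, huz, hzc⟩ := hdense u (min c v) hu (lt_min huc huv) ((min_le_right _ _).trans hv)
  refine ⟨z, hz, huz, hzc.trans_le (min_le_right _ _), ?_⟩
  by_contra! h
  exact absurd (hc z hz h huz) (not_lt.2 (hzc.le.trans (min_le_left _ _)))

/-- The data relating an element of the splitting sequence to its successor, in terms of an
injective rank function. -/
structure SplitStep (D : Set ℝ) (r : ℝ → ℕ) (x y : ℝ) : Prop where
  mem : y ∈ D
  lt : x < y
  rank_lt : r x < r y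
  split : ∀ e₁ ∈ D, ∀ e₂ ∈ D, e₁ < e₂ → r e₁ ≤ r x → r e₂ ≤ r x →
    ∃ e₃ ∈ D, r x < r e₃ ∧ r e₃ < r y ∧ e₁ < e₃ ∧ e₃ < e₂
  first : ∀ e ∈ D, r e < r y → e ≤ x ∨ y < e
  barrier : ∃ c ∈ D, r c < r y ∧ y < c ∧ ∀ e ∈ D, r e ≤ r x → x < e → c < e

lemma exists_splitStep {D : Set ℝ} {r : ℝ → ℕ} (hr : InjOn r D) (hD : D ⊆ Icc 0 1)
    (hdense : ∀ u v, 0 ≤ u → u < v → v ≤ 1 → ∃ z ∈ D, u < z ∧ z < v)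
    {x : ℝ} (hx : x ∈ D) (hx1 : x < 1) : ∃ y, SplitStep D r x y ∧ y < 1 := by
  have hfin : {e ∈ D | r e ≤ r x}.Finite :=
    Set.Finite.of_finite_image
      ((finite_Iic (r x)).subset (by rintro _ ⟨e, he, rfl⟩; exact he.2))
      (hr.mono fun e he => he.1)
  have hN : ∀ᶠ N in atTop, ∀ p ∈ {e ∈ D | r e ≤ r x} ×ˢ {e ∈ D | r e ≤ r x}, p.1 < p.2 →
      ∃ z ∈ D, r x < r z ∧ r z ≤ N ∧ p.1 < z ∧ z < p.2 := by
    rw [eventually_all_finite (hfin.prod hfin)]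
    rintro ⟨u, v⟩ ⟨⟨hu, -⟩, ⟨hv, -⟩⟩
    by_cases huv : u < v
    · obtain ⟨z, hz, huz, hzv, hrz⟩ :=
        exists_between_rank_gt hr hdense (r x) (hD hu).1 huv (hD hv).2
      filter_upwards [eventually_ge_atTop (r z)] with N hN _ using ⟨z, hz, hrz, hN, huz, hzv⟩
    · exact Eventually.of_forall fun N h => absurd h huv
  obtain ⟨N, hN, hxN⟩ := (hN.and (eventually_ge_atTop (r x))).exists
  obtain ⟨δ, hxδ, hδ⟩ := exists_gap_right hr x N
  obtain ⟨c, hc, hxc, hcδ⟩ :=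
    hdense x (min δ 1) (hD hx).1 (lt_min hxδ hx1) (min_le_right _ _)
  obtain ⟨ε, hxε, hε⟩ := exists_gap_right hr x (max N (r c))
  have hεc : ε < c := hε c hc (le_max_right _ _) hxc
  have hc1 : c ≤ 1 := (hD hc).2
  obtain ⟨w, hw, hxw, hwε⟩ := hdense x ε (hD hx).1 hxε (hεc.le.trans hc1)
  obtain ⟨y, ⟨hy, hxy, hyε⟩, hmin⟩ :=
    exists_minimalFor_of_wellFoundedLT (fun z => z ∈ D ∧ x < z ∧ z < ε) r ⟨w, hw, hxw, hwε⟩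
  have hry : max N (r c) < r y := by
    by_contra! h
    exact absurd (hε y hy h hxy) hyε.not_gt
  have hNy : N < r y := (le_max_left _ _).trans_lt hry
  refine ⟨y, ⟨hy, hxy, hxN.trans_lt hNy, ?_, ?_, c, hc, (le_max_right _ _).trans_lt hry,
    hyε.trans hεc, ?_⟩, by linarith⟩
  · intro e₁ h₁ e₂ h₂ h hr₁ hr₂
    obtain ⟨z, hz, hxz, hzN, huz, hzv⟩ := hN (e₁, e₂) ⟨⟨h₁, hr₁⟩, ⟨h₂, hr₂⟩⟩ h
    exact ⟨z, hz, hxz, hzN.trans_lt hNy, huz, hzv⟩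
  · intro e he hlt
    by_contra! h
    exact absurd (hmin ⟨he, h.1, h.2.trans_lt hyε⟩ hlt.le) hlt.not_ge
  · intro e he hex hxe
    exact (hcδ.trans_le (min_le_left _ _)).trans (hδ e he (hex.trans hxN) hxe)

lemma exists_splitStep_seq {D : Set ℝ} {r : ℝ → ℕ} (hr : InjOn r D) (hD : D ⊆ Icc 0 1)
    (hdense : ∀ u v, 0 ≤ u → u < v → v ≤ 1 → ∃ z ∈ D, u < z ∧ z < v) (h0 : (0 : ℝ) ∈ D) :
    ∃ e : ℕ → ℝ, e 0 = 0 ∧ ∀ n, SplitStep D r (e n) (e (n + 1)) := by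
  choose f hf using fun x : {x : ℝ // x ∈ D ∧ x < 1} =>
    exists_splitStep hr hD hdense x.2.1 x.2.2
  let s : ℕ → {x : ℝ // x ∈ D ∧ x < 1} := fun n =>
    Nat.rec ⟨0, h0, one_pos⟩ (fun _ x => ⟨f x, (hf x).1.mem, (hf x).2⟩) n
  refine ⟨fun n => (s n).1, rfl, fun n => ?_⟩
  exact (hf (s n)).1

/-- A linear order in which all initial segments are finite is given by a rank function. -/
lemma exists_rank {D : Set ℝ} {prec : ℝ → ℝ → Prop}
    (hirr : ∀ d ∈ D, ¬ prec d d)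
    (htrans : ∀ a ∈ D, ∀ b ∈ D, ∀ c ∈ D, prec a b → prec b c → prec a c)
    (htri : ∀ a ∈ D, ∀ b ∈ D, a ≠ b → prec a b ∨ prec b a)
    (hfin : ∀ d ∈ D, {e ∈ D | prec e d}.Finite) :
    ∃ r : ℝ → ℕ, InjOn r D ∧ ∀ a ∈ D, ∀ b ∈ D, (prec a b ↔ r a < r b) := by
  have hlt : ∀ a ∈ D, ∀ b ∈ D, prec a b →
      {e ∈ D | prec e a}.ncard < {e ∈ D | prec e b}.ncard := by
    intro a ha b hb hab
    refine ncard_lt_ncard ⟨fun e he => ⟨he.1, htrans e he.1 a ha b hb he.2 hab⟩, fun h => ?_⟩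
      (hfin b hb)
    exact hirr a ha (h ⟨ha, hab⟩).2
  have hinj : InjOn (fun d => {e ∈ D | prec e d}.ncard) D := by
    intro a ha b hb hab
    by_contra hne
    rcases htri a ha b hb hne with h | h
    · exact (hlt a ha b hb h).ne hab
    · exact (hlt b hb a ha h).ne hab.symm
  refine ⟨fun d => {e ∈ D | prec e d}.ncard, hinj, fun a ha b hb => ⟨hlt a ha b hb, fun h => ?_⟩⟩
  have hne : a ≠ b := by
    rintro rfl
    exact lt_irrefl _ h
  exact (htri a ha b hb hne).resolve_right fun h' => (hlt b hb a ha h').not_gt h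

theorem stmt1 (D : Set ℝ) (prec : ℝ → ℝ → Prop)
    (hD : D ⊆ Icc (0:ℝ) 1)
    (hdense : ∀ x ∈ Icc (0:ℝ) 1, x ∈ closure D)
    (h0 : (0:ℝ) ∈ D) (h1 : (1:ℝ) ∈ D)
    (hirr : ∀ d ∈ D, ¬ prec d d)
    (htrans : ∀ a ∈ D, ∀ b ∈ D, ∀ c ∈ D, prec a b → prec b c → prec a c)
    (htri : ∀ a ∈ D, ∀ b ∈ D, a ≠ b → prec a b ∨ prec b a)
    (hfin : ∀ d ∈ D, {e ∈ D | prec e d}.Finite)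
    (hmin : ∀ d ∈ D, d ≠ 1 → prec 1 d)
    (hsucc : prec 1 0 ∧ ∀ d ∈ D, prec 1 d → d = 0 ∨ prec 0 d) :
    ∃ e : ℕ → ℝ, ∃ a ∈ Icc (0:ℝ) 1,
      (∀ n, e n ∈ D) ∧
      e 0 = 0 ∧
      (∀ n, prec (e n) (e (n+1)) ∧ e n ≤ e (n+1)) ∧
      (∀ m n, m < n → SplitsBetween D prec (e m) (e n)) ∧
      LeftApproxSet D prec a = range e := by
  obtain ⟨r, hr, hprec⟩ := exists_rank hirr htrans htri hfin
  have hpreceq : ∀ a ∈ D, ∀ b ∈ D, (prec a b ∨ a = b) ↔ r a ≤ r b := by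
    intro a ha b hb
    rw [hprec a ha b hb, ← hr.eq_iff ha hb, le_iff_lt_or_eq]
  have hdense' : ∀ u v, 0 ≤ u → u < v → v ≤ 1 → ∃ z ∈ D, u < z ∧ z < v := by
    intro u v hu huv hv
    obtain ⟨z, hz, hzD⟩ := mem_closure_iff.1
      (hdense ((u + v) / 2) ⟨by linarith, by linarith⟩) (Ioo u v) isOpen_Ioo
      ⟨by linarith, by linarith⟩
    exact ⟨z, hzD, hz.1, hz.2⟩
  obtain ⟨e, he0, hstep⟩ := exists_splitStep_seq hr hD hdense' h0
  have hmem : ∀ n, e n ∈ D := by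
    intro n
    cases n with
    | zero => exact he0 ▸ h0
    | succ n => exact (hstep n).mem
  have hmono : StrictMono e := strictMono_nat_of_lt_succ fun n => (hstep n).lt
  have hrmono : StrictMono (fun n => r (e n)) :=
    strictMono_nat_of_lt_succ fun n => (hstep n).rank_lt
  have hbound : ∀ n m, n ≤ m → ∀ z ∈ D, r z ≤ r (e n) → e n < z → e m < z := by
    intro n m hnm z hz hzr hnz
    induction m, hnm using Nat.le_induction with
    | base => exact hnz
    | succ m hnm ih =>
      obtain ⟨c, -, -, hc, hce⟩ := (hstep m).barrier
      exact hc.trans (hce z hz (hzr.trans (hrmono.monotone hnm)) ih)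
  have hbdd : BddAbove (range e) := ⟨1, by rintro _ ⟨n, rfl⟩; exact (hD (hmem n)).2⟩
  have hle : ∀ n, e n ≤ ⨆ n, e n := le_ciSup hbdd
  have hsup : ∀ n, ∀ z ∈ D, r z ≤ r (e n) → e n < z → ⨆ n, e n < z := by
    intro n z hz hzr hnz
    obtain ⟨c, hcD, hcr, hc, hce⟩ := (hstep n).barrier
    refine (ciSup_le fun m => ?_).trans_lt (hce z hz hzr hnz)
    rcases le_total m (n + 1) with h | h
    · exact (hmono.monotone h).trans hc.le
    · exact (hbound (n + 1) m h c hcD hcr.le hc).le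
  have hgreatest : ∀ n, ∀ d ∈ D, r (e n) ≤ r d → r d < r (e (n + 1)) →
      IsGreatest {x ∈ D | (prec x d ∨ x = d) ∧ x ≤ ⨆ n, e n} (e n) := by
    intro n d hd hnd hdn
    refine ⟨⟨hmem n, (hpreceq _ (hmem n) d hd).2 hnd, hle n⟩, ?_⟩
    rintro x ⟨hx, hxd, hxa⟩
    have hxr : r x < r (e (n + 1)) := ((hpreceq x hx d hd).1 hxd).trans_lt hdn
    exact ((hstep n).first x hx hxr).resolve_right fun h =>
      (hsup (n + 1) x hx hxr.le h).not_ge hxa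
  refine ⟨e, ⨆ n, e n, ⟨he0 ▸ hle 0, ciSup_le fun n => (hD (hmem n)).2⟩, hmem, he0,
    fun n => ⟨(hprec _ (hmem n) _ (hmem _)).2 (hstep n).rank_lt, (hstep n).lt.le⟩, ?_, ?_⟩
  · intro m n hmn e₁ h₁ e₂ h₂ h hr₁ hr₂
    obtain ⟨z, hz, hmz, hzm, h₁z, hz₂⟩ := (hstep m).split e₁ h₁ e₂ h₂ h
      ((hpreceq _ h₁ _ (hmem m)).1 hr₁) ((hpreceq _ h₂ _ (hmem m)).1 hr₂)
    exact ⟨z, hz, (hprec _ (hmem m) _ hz).2 hmz,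
      (hprec _ hz _ (hmem n)).2 (hzm.trans_le (hrmono.monotone hmn)), h₁z, hz₂⟩
  · ext x
    constructor
    · rintro ⟨d, hd, h0d, hx⟩
      have h0d' : r (e 0) ≤ r d := by
        rw [he0]
        exact (hpreceq 0 h0 d hd).1 (h0d.imp_right Eq.symm)
      have hex : ∃ n, r d < r (e n) := ⟨r d + 1, hrmono.le_apply⟩
      obtain ⟨n, hn⟩ : ∃ n, Nat.find hex = n + 1 :=
        Nat.exists_eq_succ_of_ne_zero fun h => h0d'.not_gt (h ▸ Nat.find_spec hex)
      have hlt : r d < r (e (n + 1)) := hn ▸ Nat.find_spec hex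
      have hge : r (e n) ≤ r d := not_lt.1 (Nat.find_min hex (by omega))
      exact ⟨n, (hgreatest n d hd hge hlt).unique hx⟩
    · rintro ⟨n, rfl⟩
      refine ⟨e n, hmem n, ?_, hgreatest n _ (hmem n) le_rfl (hstep n).rank_lt⟩
      have := (hpreceq 0 h0 _ (hmem n)).2 (by
        simpa only [he0] using hrmono.monotone (Nat.zero_le n))
      exact this.imp_right Eq.symm
end

section
/- Let e ∈ E with e₀ ≺ e, say e = eₙ₊₁, and let a, b ∈ C with a, b ∉ D. If F_a ∩ {e₁, …, eₙ₊₁} = F_b ∩ {e₁, …, eₙ₊₁}, then l(a, eₙ₊₁) = l(b, eₙ₊₁) and r(a, eₙ₊₁) = r(b, eₙ₊₁). -/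
open Set

/-- `F_c = {e_{n+1} : l(c,e_n) ≠ l(c,e_{n+1})}`. -/
def FSet (e : ℕ → ℝ) (l : ℝ → ℝ → ℝ) (c : ℝ) : Set ℝ :=
  {x | ∃ n : ℕ, x = e (n+1) ∧ l c (e n) ≠ l c (e (n+1))}

/-- `C`: the set of `c ∈ (0,1)` such that for every `n`, either
`l(c,e_n) = l(c,e_{n+1})` or `r(c,e_n) = r(c,e_{n+1})`. -/
def CSet (e : ℕ → ℝ) (l r : ℝ → ℝ → ℝ) : Set ℝ :=
  {c ∈ Ioo (0:ℝ) 1 | ∀ n : ℕ, l c (e n) = l c (e (n+1)) ∨ r c (e n) = r c (e (n+1))}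
/-- If `a ∉ S` and `b` have the same right neighbour in `S`, then the left neighbour of `a` in `S`
is at most that of `b`. -/
theorem left_le_left_of_right_eq {S : Set ℝ} {a b p q t : ℝ} (ha : a ∉ S)
    (hp : IsGreatest {x ∈ S | x ≤ a} p) (hq : IsGreatest {x ∈ S | x ≤ b} q)
    (hta : IsLeast {x ∈ S | a ≤ x} t) (htb : IsLeast {x ∈ S | b ≤ x} t) : p ≤ q := by
  refine hq.2 ⟨hp.1.1, ?_⟩
  by_contra! h
  have h1 : t ≤ p := htb.2 ⟨hp.1.1, h.le⟩
  have h2 : a = t := le_antisymm hta.1.2 (h1.trans hp.1.2)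
  exact ha (h2 ▸ hta.1.1)

/-- If `b ∉ S` and `a` have the same left neighbour in `S`, then the right neighbour of `a` in `S`
is at most that of `b`. -/
theorem right_le_right_of_left_eq {S : Set ℝ} {a b p q t : ℝ} (hb : b ∉ S)
    (hp : IsLeast {x ∈ S | a ≤ x} p) (hq : IsLeast {x ∈ S | b ≤ x} q)
    (hta : IsGreatest {x ∈ S | x ≤ a} t) (htb : IsGreatest {x ∈ S | x ≤ b} t) : p ≤ q := by
  refine hp.2 ⟨hq.1.1, ?_⟩
  by_contra! h
  have h1 : q ≤ t := hta.2 ⟨hq.1.1, h.le⟩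
  have h2 : b = t := le_antisymm (hq.1.2.trans h1) htb.1.2
  exact hb (h2 ▸ htb.1.1)

theorem stmt2 (D : Set ℝ) (prec : ℝ → ℝ → Prop)
    (hD : D ⊆ Icc (0:ℝ) 1)
    (hdense : ∀ x ∈ Icc (0:ℝ) 1, x ∈ closure D)
    (h0 : (0:ℝ) ∈ D) (h1 : (1:ℝ) ∈ D)
    (hirr : ∀ d ∈ D, ¬ prec d d)
    (htrans : ∀ a ∈ D, ∀ b ∈ D, ∀ c ∈ D, prec a b → prec b c → prec a c)
    (htri : ∀ a ∈ D, ∀ b ∈ D, a ≠ b → prec a b ∨ prec b a)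
    (hfin : ∀ d ∈ D, {x ∈ D | prec x d}.Finite)
    (hmin : ∀ d ∈ D, d ≠ 1 → prec 1 d)
    (hsucc : prec 1 0 ∧ ∀ d ∈ D, prec 1 d → d = 0 ∨ prec 0 d)
    (e : ℕ → ℝ) (he : ∀ n, e n ∈ D) (he0 : e 0 = 0)
    (hemono : ∀ m n : ℕ, m < n → prec (e m) (e n))
    (hsplit : ∀ m n : ℕ, m < n → SplitsBetween D prec (e m) (e n))
    (l r : ℝ → ℝ → ℝ)
    (hl : ∀ c ∈ Icc (0:ℝ) 1, ∀ d ∈ D, (prec 0 d ∨ d = 0) →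
      IsGreatest {x ∈ D | (prec x d ∨ x = d) ∧ x ≤ c} (l c d))
    (hr : ∀ c ∈ Icc (0:ℝ) 1, ∀ d ∈ D, (prec 0 d ∨ d = 0) →
      IsLeast {x ∈ D | (prec x d ∨ x = d) ∧ c ≤ x} (r c d))
    (n : ℕ) (a b : ℝ)
    (ha : a ∈ CSet e l r) (hb : b ∈ CSet e l r) (haD : a ∉ D) (hbD : b ∉ D)
    (hF : FSet e l a ∩ {x | ∃ i : ℕ, 1 ≤ i ∧ i ≤ n + 1 ∧ x = e i}
        = FSet e l b ∩ {x | ∃ i : ℕ, 1 ≤ i ∧ i ≤ n + 1 ∧ x = e i}) :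
    l a (e (n+1)) = l b (e (n+1)) ∧ r a (e (n+1)) = r b (e (n+1)) := by
  have hinj : ∀ i j, e i = e j → i = j := by
    intro i j hij
    rcases lt_trichotomy i j with h | h | h
    · exact absurd (hij ▸ hemono i j h) (hirr _ (he j))
    · exact h
    · exact absurd (hij ▸ hemono j i h) (hirr _ (he j))
  have hpos : ∀ k, prec 0 (e k) ∨ e k = 0 := by
    intro k
    rcases Nat.eq_zero_or_pos k with rfl | h
    · exact Or.inr he0
    · exact Or.inl (he0 ▸ hemono 0 k h)
  let S : ℕ → Set ℝ := fun k => {x ∈ D | prec x (e k) ∨ x = e k}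
  have hmem : ∀ {c : ℝ}, c ∉ D → ∀ k, c ∉ S k := fun h k hk => h hk.1
  have hL : ∀ c ∈ CSet e l r, ∀ k, IsGreatest {x ∈ S k | x ≤ c} (l c (e k)) := by
    intro c hc k
    have := hl c (Ioo_subset_Icc_self hc.1) _ (he k) (hpos k)
    exact ⟨⟨⟨this.1.1, this.1.2.1⟩, this.1.2.2⟩, fun x hx => this.2 ⟨hx.1.1, hx.1.2, hx.2⟩⟩
  have hR : ∀ c ∈ CSet e l r, ∀ k, IsLeast {x ∈ S k | c ≤ x} (r c (e k)) := by
    intro c hc k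
    have := hr c (Ioo_subset_Icc_self hc.1) _ (he k) (hpos k)
    exact ⟨⟨⟨this.1.1, this.1.2.1⟩, this.1.2.2⟩, fun x hx => this.2 ⟨hx.1.1, hx.1.2, hx.2⟩⟩
  have hLR : ∀ k, r a (e k) = r b (e k) → l a (e k) = l b (e k) := by
    intro k h
    have hb' := hR b hb k
    rw [← h] at hb'
    exact le_antisymm
      (left_le_left_of_right_eq (hmem haD k) (hL a ha k) (hL b hb k) (hR a ha k) hb')
      (left_le_left_of_right_eq (hmem hbD k) (hL b hb k) (hL a ha k) hb' (hR a ha k))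
  have hRL : ∀ k, l a (e k) = l b (e k) → r a (e k) = r b (e k) := by
    intro k h
    have hb' := hL b hb k
    rw [← h] at hb'
    exact le_antisymm
      (right_le_right_of_left_eq (hmem hbD k) (hR a ha k) (hR b hb k) (hL a ha k) hb')
      (right_le_right_of_left_eq (hmem haD k) (hR b hb k) (hR a ha k) hb' (hL a ha k))
  have hbase : ∀ x ∈ S 0, x = 0 ∨ x = 1 := by
    rintro x ⟨hxD, hx⟩
    rw [he0] at hx
    by_contra! h
    have hx0 := hx.resolve_right h.1
    have h0x := (hsucc.2 x hxD (hmin x hxD h.2)).resolve_left h.1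
    exact hirr 0 h0 (htrans _ h0 _ hxD _ h0 h0x hx0)
  have hl0 : ∀ c ∈ CSet e l r, l c (e 0) = 0 := by
    intro c hc
    refine (hbase _ (hL c hc 0).1.1).resolve_right fun h => ?_
    have := (hL c hc 0).1.2
    linarith [hc.1.2]
  have hFmem : ∀ c k, e (k + 1) ∈ FSet e l c ↔ l c (e k) ≠ l c (e (k + 1)) := by
    intro c k
    refine ⟨?_, fun h => ⟨k, rfl, h⟩⟩
    rintro ⟨m, hm, h⟩
    obtain rfl : k = m := by simpa using hinj _ _ hm
    exact h
  have key : ∀ k ≤ n + 1, l a (e k) = l b (e k) := by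
    intro k
    induction k with
    | zero => intro _; rw [hl0 a ha, hl0 b hb]
    | succ k ih =>
      intro hk
      have hlk := ih (by omega)
      have hiff : l a (e k) ≠ l a (e (k + 1)) ↔ l b (e k) ≠ l b (e (k + 1)) := by
        have hx : e (k + 1) ∈ {x | ∃ i : ℕ, 1 ≤ i ∧ i ≤ n + 1 ∧ x = e i} :=
          ⟨k + 1, by omega, hk, rfl⟩
        have := Set.ext_iff.1 hF (e (k + 1))
        rw [← hFmem, ← hFmem]
        exact ⟨fun h => (this.1 ⟨h, hx⟩).1, fun h => (this.2 ⟨h, hx⟩).1⟩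
      by_cases h : l a (e k) = l a (e (k + 1))
      · have h' : l b (e k) = l b (e (k + 1)) := by
          by_contra h'
          exact hiff.2 h' h
        rw [← h, ← h', hlk]
      · apply hLR
        rw [← (ha.2 k).resolve_left h, ← (hb.2 k).resolve_left (hiff.1 h)]
        exact hRL k hlk
  exact ⟨key _ le_rfl, hRL _ (key _ le_rfl)⟩
end

section
/- For every X ⊆ E \ {e₀} that is neither finite nor cofinite in E, there exists a unique a ∈ C such that F_a = X. -/
open Set

/-- `x < y` are neighbours in the set `P` of reals. -/
def Consecutive (P : Set ℝ) (x y : ℝ) : Prop :=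
  x ∈ P ∧ y ∈ P ∧ x < y ∧ ∀ z ∈ P, x < z → y ≤ z

theorem Consecutive.left_unique {P : Set ℝ} {x x' y : ℝ} (h : Consecutive P x y)
    (h' : Consecutive P x' y) : x = x' := by
  obtain ⟨hx, _, hxy, hg⟩ := h
  obtain ⟨hx', _, hxy', hg'⟩ := h'
  rcases lt_trichotomy x x' with hlt | heq | hlt
  · linarith [hg x' hx' hlt]
  · exact heq
  · linarith [hg' x hx hlt]

theorem Consecutive.right_unique {P : Set ℝ} {x y y' : ℝ} (h : Consecutive P x y)
    (h' : Consecutive P x y') : y = y' :=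
  le_antisymm (h.2.2.2 y' h'.2.1 h'.2.2.1) (h'.2.2.2 y h.2.1 h.2.2.1)

theorem consecutive_of_isGreatest_of_isLeast {P : Set ℝ} {a x y : ℝ} (ha : a ∉ P)
    (hx : IsGreatest {z ∈ P | z ≤ a} x) (hy : IsLeast {z ∈ P | a ≤ z} y) :
    Consecutive P x y ∧ x < a ∧ a < y := by
  have hxa : x < a := lt_of_le_of_ne hx.1.2 fun h => ha (h ▸ hx.1.1)
  have hay : a < y := lt_of_le_of_ne hy.1.2 fun h => ha (h ▸ hy.1.1)
  refine ⟨⟨hx.1.1, hy.1.1, hxa.trans hay, fun z hz hxz => ?_⟩, hxa, hay⟩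
  rcases le_total z a with h | h
  · linarith [hx.2 ⟨hz, h⟩]
  · exact hy.2 ⟨hz, h⟩

theorem Consecutive.isGreatest {P : Set ℝ} {a x y : ℝ} (h : Consecutive P x y)
    (hx : x < a) (hy : a < y) : IsGreatest {z ∈ P | z ≤ a} x := by
  refine ⟨⟨h.1, hx.le⟩, fun z hz => ?_⟩
  by_contra! hlt
  linarith [h.2.2.2 z hz.1 hlt, hz.2]

theorem Consecutive.isLeast {P : Set ℝ} {a x y : ℝ} (h : Consecutive P x y)
    (hx : x < a) (hy : a < y) : IsLeast {z ∈ P | a ≤ z} y :=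
  ⟨⟨h.2.1, hy.le⟩, fun z hz => h.2.2.2 z hz.1 (hx.trans_le hz.2)⟩

theorem Consecutive.exists_refine_left {P Q : Set ℝ} (hQ : Q.Finite) (hPQ : P ⊆ Q) {x y : ℝ}
    (h : Consecutive P x y) (hs : ∃ z ∈ Q, x < z ∧ z < y) :
    ∃ x', x < x' ∧ Consecutive Q x' y := by
  obtain ⟨z, hz, hxz, hzy⟩ := hs
  obtain ⟨m, hm, hmax⟩ := Set.exists_max_image {w ∈ Q | w < y} id
    (hQ.subset fun _ hw => hw.1) ⟨z, hz, hzy⟩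
  refine ⟨m, hxz.trans_le (hmax z ⟨hz, hzy⟩), hm.1, hPQ h.2.1, hm.2, fun w hw hmw => ?_⟩
  by_contra! hwy
  exact (hmax w ⟨hw, hwy⟩).not_gt hmw

theorem Consecutive.exists_refine_right {P Q : Set ℝ} (hQ : Q.Finite) (hPQ : P ⊆ Q) {x y : ℝ}
    (h : Consecutive P x y) (hs : ∃ z ∈ Q, x < z ∧ z < y) :
    ∃ y', y' < y ∧ Consecutive Q x y' := by
  obtain ⟨z, hz, hxz, hzy⟩ := hs
  obtain ⟨m, hm, hmin⟩ := Set.exists_min_image {w ∈ Q | x < w} id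
    (hQ.subset fun _ hw => hw.1) ⟨z, hz, hxz⟩
  exact ⟨m, (hmin z ⟨hz, hxz⟩).trans_lt hzy, hPQ h.1, hm.1, hm.2,
    fun w hw hxw => hmin w ⟨hw, hxw⟩⟩

theorem exists_lt_of_infinite_lt_succ {f : ℕ → ℝ} (hf : Monotone f) {S : Set ℕ} (hS : S.Infinite)
    (hlt : ∀ n ∈ S, f n < f (n + 1)) (n : ℕ) : ∃ m, f n < f m := by
  obtain ⟨m, hm, hnm⟩ := hS.exists_gt n
  exact ⟨m + 1, (hf hnm.le).trans_lt (hlt m hm)⟩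

theorem exists_nested_consecutive {P : ℕ → Set ℝ} (hP : ∀ n, (P n).Finite) (hmono : Monotone P)
    (hsplit : ∀ n, ∀ x ∈ P n, ∀ y ∈ P n, x < y → ∃ z ∈ P (n + 1), x < z ∧ z < y)
    (h0 : Consecutive (P 0) 0 1) (S : Set ℕ) :
    ∃ f : ℕ → ℝ × ℝ, f 0 = (0, 1) ∧ ∀ n, Consecutive (P n) (f n).1 (f n).2 ∧
      (n ∈ S → (f n).1 < (f (n + 1)).1 ∧ (f (n + 1)).2 = (f n).2) ∧
      (n ∉ S → (f (n + 1)).1 = (f n).1 ∧ (f (n + 1)).2 < (f n).2) := by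
  have step : ∀ n (p : ℝ × ℝ), ∃ q : ℝ × ℝ, Consecutive (P n) p.1 p.2 →
      Consecutive (P (n + 1)) q.1 q.2 ∧ (n ∈ S → p.1 < q.1 ∧ q.2 = p.2) ∧
      (n ∉ S → q.1 = p.1 ∧ q.2 < p.2) := by
    intro n p
    by_cases hc : Consecutive (P n) p.1 p.2
    · have hs := hsplit n _ hc.1 _ hc.2.1 hc.2.2.1
      have hle := hmono (Nat.le_succ n)
      by_cases hn : n ∈ S
      · obtain ⟨x, hx, hcx⟩ := hc.exists_refine_left (hP (n + 1)) hle hs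
        exact ⟨(x, p.2), fun _ => ⟨hcx, fun _ => ⟨hx, rfl⟩, fun h => absurd hn h⟩⟩
      · obtain ⟨y, hy, hcy⟩ := hc.exists_refine_right (hP (n + 1)) hle hs
        exact ⟨(p.1, y), fun _ => ⟨hcy, fun h => absurd h hn, fun _ => ⟨rfl, hy⟩⟩⟩
    · exact ⟨p, fun h => absurd h hc⟩
  choose g hg using step
  let f : ℕ → ℝ × ℝ := fun n => Nat.rec (0, 1) g n
  have hc : ∀ n, Consecutive (P n) (f n).1 (f n).2 := by
    intro n
    induction n with
    | zero => exact h0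
    | succ n ih => exact (hg n (f n) ih).1
  exact ⟨f, rfl, fun n => ⟨hc n, (hg n (f n) (hc n)).2⟩⟩

theorem existsUnique_of_itinerary {P : ℕ → Set ℝ} (hP : ∀ n, (P n).Finite) (hmono : Monotone P)
    (hsplit : ∀ n, ∀ x ∈ P n, ∀ y ∈ P n, x < y → ∃ z ∈ P (n + 1), x < z ∧ z < y)
    (h0 : Consecutive (P 0) 0 1)
    (hdense : ∀ a ∈ Icc (0 : ℝ) 1, ∀ b ∈ Icc (0 : ℝ) 1, a < b → ∃ n, ∃ d ∈ P n, a < d ∧ d < b)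
    {l r : ℝ → ℕ → ℝ}
    (hl : ∀ c ∈ Icc (0 : ℝ) 1, ∀ n, IsGreatest {x ∈ P n | x ≤ c} (l c n))
    (hr : ∀ c ∈ Icc (0 : ℝ) 1, ∀ n, IsLeast {x ∈ P n | c ≤ x} (r c n))
    {S : Set ℕ} (hS : S.Infinite) (hS' : Sᶜ.Infinite) :
    ∃! a : ℝ, (a ∈ Ioo (0 : ℝ) 1 ∧ ∀ n, l a n = l a (n + 1) ∨ r a n = r a (n + 1)) ∧
      ∀ n, l a n ≠ l a (n + 1) ↔ n ∈ S := by
  refine existsUnique_of_exists_of_unique ?_ ?_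
  · obtain ⟨f, hf0, hf⟩ := exists_nested_consecutive hP hmono hsplit h0 S
    have hL : Monotone fun n => (f n).1 := monotone_nat_of_le_succ fun n => by
      by_cases hn : n ∈ S
      · exact ((hf n).2.1 hn).1.le
      · exact ((hf n).2.2 hn).1.ge
    have hR : Monotone fun n => -(f n).2 := monotone_nat_of_le_succ fun n => by
      by_cases hn : n ∈ S
      · exact neg_le_neg ((hf n).2.1 hn).2.le
      · exact neg_le_neg ((hf n).2.2 hn).2.le
    have hLR : ∀ m n, (f m).1 ≤ (f n).2 := fun m n => by
      have h1 := hL (le_max_left m n)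
      have h2 := hR (le_max_right m n)
      have h3 := (hf (max m n)).1.2.2.1
      dsimp only at h1 h2
      linarith
    have hbdd : BddAbove (range fun n => (f n).1) :=
      ⟨(f 0).2, by rintro _ ⟨m, rfl⟩; exact hLR m 0⟩
    have hla : ∀ n, (f n).1 < ⨆ n, (f n).1 := fun n => by
      obtain ⟨m, hm⟩ := exists_lt_of_infinite_lt_succ hL hS (fun n hn => ((hf n).2.1 hn).1) n
      exact hm.trans_le (le_ciSup hbdd m)
    have har : ∀ n, ⨆ n, (f n).1 < (f n).2 := fun n => by
      obtain ⟨m, hm⟩ := exists_lt_of_infinite_lt_succ hR hS'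
        (fun n hn => neg_lt_neg ((hf n).2.2 hn).2) n
      exact (ciSup_le fun k => hLR k m).trans_lt (neg_lt_neg_iff.1 hm)
    set a := ⨆ n, (f n).1
    have ha : a ∈ Ioo (0 : ℝ) 1 := ⟨by simpa [hf0] using hla 0, by simpa [hf0] using har 0⟩
    have hl' : ∀ n, l a n = (f n).1 := fun n =>
      (hl a (Ioo_subset_Icc_self ha) n).unique ((hf n).1.isGreatest (hla n) (har n))
    have hr' : ∀ n, r a n = (f n).2 := fun n =>
      (hr a (Ioo_subset_Icc_self ha) n).unique ((hf n).1.isLeast (hla n) (har n))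
    refine ⟨a, ⟨ha, fun n => ?_⟩, fun n => ?_⟩
    · rw [hl', hl', hr', hr']
      by_cases hn : n ∈ S
      · exact Or.inr ((hf n).2.1 hn).2.symm
      · exact Or.inl ((hf n).2.2 hn).1.symm
    · rw [hl', hl']
      by_cases hn : n ∈ S
      · exact iff_of_true ((hf n).2.1 hn).1.ne hn
      · exact iff_of_false (fun h => h ((hf n).2.2 hn).1.symm) hn
  · have key : ∀ a, ((a ∈ Ioo (0 : ℝ) 1 ∧ ∀ n, l a n = l a (n + 1) ∨ r a n = r a (n + 1)) ∧
        ∀ n, l a n ≠ l a (n + 1) ↔ n ∈ S) → ∀ n, Consecutive (P n) (l a n) (r a n) ∧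
        (n ∈ S → r a (n + 1) = r a n) ∧ (n ∉ S → l a (n + 1) = l a n) := by
      rintro a ⟨⟨ha, hC⟩, hF⟩ n
      have haI := Ioo_subset_Icc_self ha
      have hnot : ∀ n, a ∉ P n := by
        intro m hm
        obtain ⟨k, hk, hmk⟩ := hS.exists_gt m
        have hla : ∀ j, m ≤ j → l a j = a := fun j hj =>
          le_antisymm (hl a haI j).1.2 ((hl a haI j).2 ⟨hmono hj hm, le_rfl⟩)
        exact (hF k).2 hk ((hla k hmk.le).trans (hla (k + 1) (by omega)).symm)
      refine ⟨(consecutive_of_isGreatest_of_isLeast (hnot n) (hl a haI n) (hr a haI n)).1,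
        fun hn => ?_, fun hn => ?_⟩
      · exact ((hC n).resolve_left ((hF n).2 hn)).symm
      · by_contra h
        exact hn ((hF n).1 (Ne.symm h))
    intro a b ha hb
    have hka := key a ha
    have hkb := key b hb
    have heq : ∀ n, l a n = l b n ∧ r a n = r b n := by
      intro n
      induction n with
      | zero =>
        have ha0 := h0.isGreatest ha.1.1.1 ha.1.1.2
        have ha1 := h0.isLeast ha.1.1.1 ha.1.1.2
        have hb0 := h0.isGreatest hb.1.1.1 hb.1.1.2
        have hb1 := h0.isLeast hb.1.1.1 hb.1.1.2
        have haI := Ioo_subset_Icc_self ha.1.1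
        have hbI := Ioo_subset_Icc_self hb.1.1
        exact ⟨((hl a haI 0).unique ha0).trans ((hl b hbI 0).unique hb0).symm,
          ((hr a haI 0).unique ha1).trans ((hr b hbI 0).unique hb1).symm⟩
      | succ n ih =>
        have hca := (hka (n + 1)).1
        have hcb := (hkb (n + 1)).1
        by_cases hn : n ∈ S
        · have hrr : r a (n + 1) = r b (n + 1) := by
            rw [(hka n).2.1 hn, (hkb n).2.1 hn, ih.2]
          exact ⟨(hrr ▸ hca).left_unique hcb, hrr⟩
        · have hll : l a (n + 1) = l b (n + 1) := by
            rw [(hka n).2.2 hn, (hkb n).2.2 hn, ih.1]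
          exact ⟨hll, (hll ▸ hca).right_unique hcb⟩
    have no_gap : ∀ a ∈ Ioo (0 : ℝ) 1, ∀ b ∈ Ioo (0 : ℝ) 1, (∀ n, l a n = l b n) → ¬ a < b := by
      intro a ha b hb hab hlt
      have haI := Ioo_subset_Icc_self ha
      have hbI := Ioo_subset_Icc_self hb
      obtain ⟨n, d, hd, had, hdb⟩ := hdense a haI b hbI hlt
      have h1 := (hl a haI n).1.2
      have h2 := (hl b hbI n).2 ⟨hd, hdb.le⟩
      rw [← hab n] at h2
      linarith
    exact le_antisymm (le_of_not_gt (no_gap b hb.1.1 a ha.1.1 fun n => (heq n).1.symm))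
      (le_of_not_gt (no_gap a ha.1.1 b hb.1.1 fun n => (heq n).1))

theorem stmt3 (D : Set ℝ) (prec : ℝ → ℝ → Prop)
    (hD : D ⊆ Icc (0:ℝ) 1)
    (hdense : ∀ x ∈ Icc (0:ℝ) 1, x ∈ closure D)
    (h0 : (0:ℝ) ∈ D) (h1 : (1:ℝ) ∈ D)
    (hirr : ∀ d ∈ D, ¬ prec d d)
    (htrans : ∀ a ∈ D, ∀ b ∈ D, ∀ c ∈ D, prec a b → prec b c → prec a c)
    (htri : ∀ a ∈ D, ∀ b ∈ D, a ≠ b → prec a b ∨ prec b a)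
    (hfin : ∀ d ∈ D, {x ∈ D | prec x d}.Finite)
    (hmin : ∀ d ∈ D, d ≠ 1 → prec 1 d)
    (hsucc : prec 1 0 ∧ ∀ d ∈ D, prec 1 d → d = 0 ∨ prec 0 d)
    (e : ℕ → ℝ) (he : ∀ n, e n ∈ D) (he0 : e 0 = 0)
    (hemono : ∀ m n : ℕ, m < n → prec (e m) (e n))
    (hsplit : ∀ m n : ℕ, m < n → SplitsBetween D prec (e m) (e n))
    (l r : ℝ → ℝ → ℝ)
    (hl : ∀ c ∈ Icc (0:ℝ) 1, ∀ d ∈ D, (prec 0 d ∨ d = 0) →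
      IsGreatest {x ∈ D | (prec x d ∨ x = d) ∧ x ≤ c} (l c d))
    (hr : ∀ c ∈ Icc (0:ℝ) 1, ∀ d ∈ D, (prec 0 d ∨ d = 0) →
      IsLeast {x ∈ D | (prec x d ∨ x = d) ∧ c ≤ x} (r c d))
    (X : Set ℝ)
    (hX : X ⊆ range e \ {e 0})
    (hXinf : ¬ X.Finite)
    (hXcoinf : ¬ (range e \ X).Finite) :
    ∃! a : ℝ, a ∈ CSet e l r ∧ FSet e l a = X := by
  have hle0 : ∀ n, prec 0 (e n) ∨ e n = 0 := fun n => by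
    rcases Nat.eq_zero_or_pos n with rfl | hn
    · exact Or.inr he0
    · exact Or.inl (he0 ▸ hemono 0 n hn)
  have hinj : Function.Injective e := by
    intro m n hmn
    rcases lt_trichotomy m n with h | h | h
    · exact absurd (hmn ▸ hemono m n h) (hirr _ (he _))
    · exact h
    · exact absurd (hmn ▸ hemono n m h) (hirr _ (he _))
  let P : ℕ → Set ℝ := fun n => {x ∈ D | prec x (e n) ∨ x = e n}
  have hP : ∀ n, (P n).Finite := fun n =>
    ((hfin (e n) (he n)).union (finite_singleton (e n))).subset
      fun x hx => hx.2.imp (fun h => ⟨hx.1, h⟩) id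
  have hmono : Monotone P := by
    intro m n hmn x hx
    rcases hmn.eq_or_lt with rfl | hlt
    · exact hx
    · refine ⟨hx.1, Or.inl ?_⟩
      rcases hx.2 with h | h
      · exact htrans x hx.1 _ (he m) _ (he n) h (hemono m n hlt)
      · exact h ▸ hemono m n hlt
  have hcons : Consecutive (P 0) 0 1 := by
    refine ⟨⟨h0, Or.inr he0.symm⟩, ⟨h1, Or.inl (he0 ▸ hsucc.1)⟩, one_pos, fun z hz hz0 => ?_⟩
    rcases hz.2 with h | h
    · rw [he0] at h
      by_contra! hz1
      rcases hsucc.2 z hz.1 (hmin z hz.1 hz1.ne) with h' | h'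
      · exact hz0.ne' h'
      · exact hirr 0 h0 (htrans 0 h0 z hz.1 0 h0 h' h)
    · exact absurd (h.trans he0) hz0.ne'
  have hexh : ∀ d ∈ D, ∃ n, d ∈ P n := by
    intro d hd
    by_contra! h
    refine (infinite_range_of_injective hinj) ((hfin d hd).subset ?_)
    rintro _ ⟨n, rfl⟩
    refine ⟨he n, (htri _ (he n) d hd fun hn => h n ⟨hd, Or.inr hn.symm⟩).resolve_right
      fun hn => h n ⟨hd, Or.inl hn⟩⟩
  have hden : ∀ a ∈ Icc (0 : ℝ) 1, ∀ b ∈ Icc (0 : ℝ) 1, a < b →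
      ∃ n, ∃ d ∈ P n, a < d ∧ d < b := by
    intro a ha b hb hab
    obtain ⟨d, ⟨had, hdb⟩, hd⟩ := mem_closure_iff.1
      (hdense ((a + b) / 2) ⟨by linarith [ha.1, hb.1], by linarith [ha.2, hb.2]⟩)
      (Ioo a b) isOpen_Ioo ⟨by linarith, by linarith⟩
    obtain ⟨n, hn⟩ := hexh d hd
    exact ⟨n, d, hn, had, hdb⟩
  have hsp : ∀ n, ∀ x ∈ P n, ∀ y ∈ P n, x < y → ∃ z ∈ P (n + 1), x < z ∧ z < y := by
    intro n x hx y hy hxy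
    obtain ⟨z, hz, _, hzn, hxz, hzy⟩ :=
      hsplit n (n + 1) n.lt_succ_self x hx.1 y hy.1 hxy hx.2 hy.2
    exact ⟨z, ⟨hz, Or.inl hzn⟩, hxz, hzy⟩
  have hl' : ∀ c ∈ Icc (0 : ℝ) 1, ∀ n, IsGreatest {x ∈ P n | x ≤ c} (l c (e n)) := by
    intro c hc n
    convert hl c hc (e n) (he n) (hle0 n) using 1
    ext x
    exact and_assoc
  have hr' : ∀ c ∈ Icc (0 : ℝ) 1, ∀ n, IsLeast {x ∈ P n | c ≤ x} (r c (e n)) := by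
    intro c hc n
    convert hr c hc (e n) (he n) (hle0 n) using 1
    ext x
    exact and_assoc
  have hS : {n | e (n + 1) ∈ X}.Infinite := by
    intro hf
    refine hXinf ((hf.image fun n => e (n + 1)).subset fun x hx => ?_)
    obtain ⟨⟨n, rfl⟩, hn0⟩ := hX hx
    cases n with
    | zero => exact absurd rfl hn0
    | succ n => exact ⟨n, hx, rfl⟩
  have hS' : {n | e (n + 1) ∈ X}ᶜ.Infinite := by
    intro hf
    refine hXcoinf (((hf.image fun n => e (n + 1)).insert (e 0)).subset ?_)
    rintro _ ⟨⟨n, rfl⟩, hn⟩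
    cases n with
    | zero => exact Or.inl rfl
    | succ n => exact Or.inr ⟨n, hn, rfl⟩
  have hF : ∀ a, FSet e l a = X ↔ ∀ n, l a (e n) ≠ l a (e (n + 1)) ↔ n ∈ {n | e (n + 1) ∈ X} := by
    intro a
    have hmem : ∀ n, e (n + 1) ∈ FSet e l a ↔ l a (e n) ≠ l a (e (n + 1)) := by
      refine fun n => ⟨?_, fun h => ⟨n, rfl, h⟩⟩
      rintro ⟨m, hm, h⟩
      rwa [Nat.succ_injective (hinj hm)]
    refine ⟨fun h n => by rw [← hmem, h]; rfl, fun h => ?_⟩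
    ext x
    constructor
    · rintro ⟨n, rfl, hn⟩
      exact (h n).1 hn
    · intro hx
      obtain ⟨⟨n, rfl⟩, hn0⟩ := hX hx
      cases n with
      | zero => exact absurd rfl hn0
      | succ n => exact (hmem n).2 ((h n).2 hx)
  simp only [hF]
  exact existsUnique_of_itinerary (l := fun c n => l c (e n)) (r := fun c n => r c (e n))
    hP hmono hsp hcons hden hl' hr' hS hS'
end

section
/- For every finite X ⊆ E \ {e₀} there exists a unique d ∈ B such that F_d = X. -/
open Set

/-- `A`: the set of `c ∈ C` such that `F_c` is neither finite nor cofinite in `E`. -/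
def ASet (e : ℕ → ℝ) (l r : ℝ → ℝ → ℝ) : Set ℝ :=
  {c ∈ CSet e l r | ¬ (FSet e l c).Finite ∧ ¬ (range e \ FSet e l c).Finite}

/-- `B`: the set of `d ∈ D` of the form `d = l(c, e_n)` for some `c ∈ A` and `n`. -/
def BSet (D : Set ℝ) (e : ℕ → ℝ) (l r : ℝ → ℝ → ℝ) : Set ℝ :=
  {d ∈ D | ∃ c ∈ ASet e l r, ∃ n : ℕ, d = l c (e n)}

/-- `a < b` are consecutive elements of `s`. -/
def IsGap (s : Set ℝ) (a b : ℝ) : Prop :=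
  a ∈ s ∧ b ∈ s ∧ a < b ∧ ∀ x ∈ s, x ≤ a ∨ b ≤ x

theorem IsGap.isGreatest {s : Set ℝ} {a b c : ℝ} (h : IsGap s a b) (hac : a ≤ c) (hcb : c < b) :
    IsGreatest {x ∈ s | x ≤ c} a :=
  ⟨⟨h.1, hac⟩, fun x hx => (h.2.2.2 x hx.1).resolve_right fun hb => by linarith [hx.2]⟩

theorem IsGap.isLeast {s : Set ℝ} {a b c : ℝ} (h : IsGap s a b) (hac : a < c) (hcb : c ≤ b) :
    IsLeast {x ∈ s | c ≤ x} b :=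
  ⟨⟨h.2.1, hcb⟩, fun x hx => (h.2.2.2 x hx.1).resolve_left fun hb => by linarith [hx.2]⟩

theorem isGap_of_isGreatest_of_isLeast {s : Set ℝ} {a b c : ℝ} (hc : c ∉ s)
    (ha : IsGreatest {x ∈ s | x ≤ c} a) (hb : IsLeast {x ∈ s | c ≤ x} b) : IsGap s a b := by
  refine ⟨ha.1.1, hb.1.1, ?_, fun x hx => ?_⟩
  · refine lt_of_le_of_ne (ha.1.2.trans hb.1.2) fun hab => hc ?_
    rw [le_antisymm (hb.1.2.trans hab.ge) ha.1.2]
    exact ha.1.1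
  · exact (le_total x c).imp (fun h => ha.2 ⟨hx, h⟩) (fun h => hb.2 ⟨hx, h⟩)

theorem IsGap.left_unique {s : Set ℝ} {a a' b : ℝ} (h : IsGap s a b) (h' : IsGap s a' b) :
    a = a' :=
  le_antisymm ((h'.2.2.2 a h.1).resolve_right h.2.2.1.not_ge)
    ((h.2.2.2 a' h'.1).resolve_right h'.2.2.1.not_ge)

theorem IsGap.right_unique {s : Set ℝ} {a b b' : ℝ} (h : IsGap s a b) (h' : IsGap s a b') :
    b = b' :=
  le_antisymm ((h.2.2.2 b' h'.2.1).resolve_left h'.2.2.1.not_ge)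
    ((h'.2.2.2 b h.2.1).resolve_left h.2.2.1.not_ge)

/-- Refining a gap while keeping its right endpoint. -/
theorem IsGap.exists_left {s t : Set ℝ} {a b x : ℝ} (h : IsGap s a b) (hst : s ⊆ t)
    (ht : t.Finite) (hx : x ∈ t) (hax : a < x) (hxb : x < b) : ∃ a', a < a' ∧ IsGap t a' b := by
  obtain ⟨m, ⟨hmt, hmb⟩, hm⟩ :=
    exists_max_image {y ∈ t | y < b} id (ht.subset (sep_subset _ _)) ⟨x, hx, hxb⟩
  exact ⟨m, hax.trans_le (hm x ⟨hx, hxb⟩), hmt, hst h.2.1, hmb,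
    fun y hy => (lt_or_ge y b).imp_left fun hyb => hm y ⟨hy, hyb⟩⟩

/-- Refining a gap while keeping its left endpoint. -/
theorem IsGap.exists_right {s t : Set ℝ} {a b x : ℝ} (h : IsGap s a b) (hst : s ⊆ t)
    (ht : t.Finite) (hx : x ∈ t) (hax : a < x) (hxb : x < b) : ∃ b', b' < b ∧ IsGap t a b' := by
  obtain ⟨m, ⟨hmt, hma⟩, hm⟩ :=
    exists_min_image {y ∈ t | a < y} id (ht.subset (sep_subset _ _)) ⟨x, hx, hax⟩
  exact ⟨m, (hm x ⟨hx, hax⟩).trans_lt hxb, hst h.1, hmt, hma,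
    fun y hy => (le_or_gt y a).imp_right fun hya => hm y ⟨hy, hya⟩⟩

/-- Nested gaps in a refining sequence of finite sets, with a prescribed pattern `S` of moves:
the left endpoint moves exactly at the steps in `S`, the right one at the others. -/
theorem exists_nested_gaps {Δ : ℕ → Set ℝ} (hfin : ∀ n, (Δ n).Finite) (hmono : Monotone Δ)
    (hsplit : ∀ n, ∀ a ∈ Δ n, ∀ b ∈ Δ n, a < b → ∃ x ∈ Δ (n + 1), a < x ∧ x < b)
    {a₀ b₀ : ℝ} (h₀ : IsGap (Δ 0) a₀ b₀) (S : Set ℕ) :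
    ∃ a b : ℕ → ℝ, a 0 = a₀ ∧ b 0 = b₀ ∧ (∀ n, IsGap (Δ n) (a n) (b n)) ∧
      (∀ n ∈ S, a n < a (n + 1) ∧ b (n + 1) = b n) ∧
      (∀ n ∉ S, a (n + 1) = a n ∧ b (n + 1) < b n) := by
  have step : ∀ n (p : {p : ℝ × ℝ // IsGap (Δ n) p.1 p.2}),
      ∃ q : {q : ℝ × ℝ // IsGap (Δ (n + 1)) q.1 q.2},
        (n ∈ S → p.1.1 < q.1.1 ∧ q.1.2 = p.1.2) ∧ (n ∉ S → q.1.1 = p.1.1 ∧ q.1.2 < p.1.2) := by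
    rintro n ⟨⟨a, b⟩, h⟩
    obtain ⟨x, hx, hax, hxb⟩ := hsplit n a h.1 b h.2.1 h.2.2.1
    by_cases hn : n ∈ S
    · obtain ⟨a', haa, h'⟩ := h.exists_left (hmono n.le_succ) (hfin _) hx hax hxb
      exact ⟨⟨(a', b), h'⟩, fun _ => ⟨haa, rfl⟩, fun h => absurd hn h⟩
    · obtain ⟨b', hbb, h'⟩ := h.exists_right (hmono n.le_succ) (hfin _) hx hax hxb
      exact ⟨⟨(a, b'), h'⟩, fun h => absurd h hn, fun _ => ⟨rfl, hbb⟩⟩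
  choose f hf using step
  let s : ∀ n, {p : ℝ × ℝ // IsGap (Δ n) p.1 p.2} := fun n => Nat.rec ⟨(a₀, b₀), h₀⟩ f n
  exact ⟨fun n => (s n).1.1, fun n => (s n).1.2, rfl, rfl, fun n => (s n).2,
    fun n hn => (hf n (s n)).1 hn, fun n hn => (hf n (s n)).2 hn⟩

/-- Nested gaps whose endpoints both move infinitely often have a common interior point. -/
theorem exists_mem_Ioo_of_nested {a b : ℕ → ℝ} {S : Set ℕ} (hab : ∀ n, a n < b n)
    (hS : ∀ n ∈ S, a n < a (n + 1) ∧ b (n + 1) = b n)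
    (hS' : ∀ n ∉ S, a (n + 1) = a n ∧ b (n + 1) < b n)
    (hinf : S.Infinite) (hinf' : Sᶜ.Infinite) : ∃ c, ∀ n, c ∈ Ioo (a n) (b n) := by
  have ha : Monotone a := monotone_nat_of_le_succ fun n => by
    by_cases hn : n ∈ S
    exacts [(hS n hn).1.le, (hS' n hn).1.ge]
  have hb : Antitone b := antitone_nat_of_succ_le fun n => by
    by_cases hn : n ∈ S
    exacts [(hS n hn).2.le, (hS' n hn).2.le]
  have hle : ∀ m n, a m ≤ b n := fun m n =>
    (ha (le_max_left m n)).trans ((hab _).le.trans (hb (le_max_right m n)))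
  refine ⟨⨆ n, a n, fun n => ⟨?_, ?_⟩⟩
  · obtain ⟨m, hm, hnm⟩ := hinf.exists_gt n
    exact ((ha hnm.le).trans_lt (hS m hm).1).trans_le
      (le_ciSup ⟨b 0, forall_mem_range.2 fun k => hle k 0⟩ _)
  · obtain ⟨m, hm, hnm⟩ := hinf'.exists_gt n
    exact (ciSup_le fun k => hle k (m + 1)).trans_lt ((hS' m hm).2.trans_le (hb hnm.le))

section FSet

variable {e : ℕ → ℝ} {l r : ℝ → ℝ → ℝ} {Δ : ℕ → Set ℝ}

theorem succ_mem_FSet_iff (he : Function.Injective e) {c : ℝ} {n : ℕ} :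
    e (n + 1) ∈ FSet e l c ↔ l c (e n) ≠ l c (e (n + 1)) := by
  refine ⟨?_, fun h => ⟨n, rfl, h⟩⟩
  rintro ⟨m, hm, h⟩
  obtain rfl : n = m := by simpa using he hm
  exact h

theorem notMem_of_mem_CSet
    (hl : ∀ c ∈ Icc (0 : ℝ) 1, ∀ n, IsGreatest {x ∈ Δ n | x ≤ c} (l c (e n)))
    (hr : ∀ c ∈ Icc (0 : ℝ) 1, ∀ n, IsLeast {x ∈ Δ n | c ≤ x} (r c (e n)))
    (hΔ0 : Δ 0 = {0, 1}) {c : ℝ} (hc : c ∈ CSet e l r) (n : ℕ) : c ∉ Δ n := by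
  have hcI := Ioo_subset_Icc_self hc.1
  induction n with
  | zero =>
    rw [hΔ0]
    rintro (h | h)
    exacts [hc.1.1.ne' h, hc.1.2.ne h]
  | succ n ih =>
    intro h
    have h1 : l c (e (n + 1)) = c :=
      (hl c hcI (n + 1)).unique ⟨⟨h, le_rfl⟩, fun x hx => hx.2⟩
    have h2 : r c (e (n + 1)) = c :=
      (hr c hcI (n + 1)).unique ⟨⟨h, le_rfl⟩, fun x hx => hx.2⟩
    rcases hc.2 n with h' | h'
    · exact ih (h1 ▸ h' ▸ (hl c hcI n).1.1)
    · exact ih (h2 ▸ h' ▸ (hr c hcI n).1.1)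

theorem left_left_of_le (hmono : Monotone Δ) (hΔI : ∀ n, Δ n ⊆ Icc 0 1)
    (hl : ∀ c ∈ Icc (0 : ℝ) 1, ∀ n, IsGreatest {x ∈ Δ n | x ≤ c} (l c (e n)))
    {c : ℝ} (hc : c ∈ Icc (0 : ℝ) 1) {m n : ℕ} (hmn : m ≤ n) :
    l (l c (e n)) (e m) = l c (e m) :=
  (hl _ (hΔI n (hl c hc n).1.1) m).unique
    ⟨⟨(hl c hc m).1.1, (hl c hc n).2 ⟨hmono hmn (hl c hc m).1.1, (hl c hc m).1.2⟩⟩,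
      fun _ hx => (hl c hc m).2 ⟨hx.1, hx.2.trans (hl c hc n).1.2⟩⟩

theorem left_left_of_ge (hmono : Monotone Δ) (hΔI : ∀ n, Δ n ⊆ Icc 0 1)
    (hl : ∀ c ∈ Icc (0 : ℝ) 1, ∀ n, IsGreatest {x ∈ Δ n | x ≤ c} (l c (e n)))
    {c : ℝ} (hc : c ∈ Icc (0 : ℝ) 1) {m n : ℕ} (hnm : n ≤ m) :
    l (l c (e n)) (e m) = l c (e n) :=
  (hl _ (hΔI n (hl c hc n).1.1) m).unique
    ⟨⟨hmono hnm (hl c hc n).1.1, le_rfl⟩, fun _ hx => hx.2⟩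

theorem succ_mem_FSet_left_iff (he : Function.Injective e) (hmono : Monotone Δ)
    (hΔI : ∀ n, Δ n ⊆ Icc 0 1)
    (hl : ∀ c ∈ Icc (0 : ℝ) 1, ∀ n, IsGreatest {x ∈ Δ n | x ≤ c} (l c (e n)))
    {c : ℝ} (hc : c ∈ Icc (0 : ℝ) 1) {m n : ℕ} :
    e (m + 1) ∈ FSet e l (l c (e n)) ↔ m < n ∧ e (m + 1) ∈ FSet e l c := by
  rw [succ_mem_FSet_iff he, succ_mem_FSet_iff he]
  rcases lt_or_ge m n with h | h
  · rw [left_left_of_le hmono hΔI hl hc h, left_left_of_le hmono hΔI hl hc h.le]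
    simp [h]
  · rw [left_left_of_ge hmono hΔI hl hc h, left_left_of_ge hmono hΔI hl hc (h.trans m.le_succ)]
    simp [h.not_gt]

/-- Points of `CSet` with the same moves before step `n` lie in the same gap at step `n`. -/
theorem left_right_eq_of_FSet_agree (he : Function.Injective e)
    (hl : ∀ c ∈ Icc (0 : ℝ) 1, ∀ n, IsGreatest {x ∈ Δ n | x ≤ c} (l c (e n)))
    (hr : ∀ c ∈ Icc (0 : ℝ) 1, ∀ n, IsLeast {x ∈ Δ n | c ≤ x} (r c (e n)))
    (hΔ0 : Δ 0 = {0, 1}) {c c' : ℝ} (hc : c ∈ CSet e l r) (hc' : c' ∈ CSet e l r) (n : ℕ)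
    (h : ∀ m < n, e (m + 1) ∈ FSet e l c ↔ e (m + 1) ∈ FSet e l c') :
    l c (e n) = l c' (e n) ∧ r c (e n) = r c' (e n) := by
  have gap : ∀ {c}, c ∈ CSet e l r → ∀ n, IsGap (Δ n) (l c (e n)) (r c (e n)) := fun hc n =>
    isGap_of_isGreatest_of_isLeast (notMem_of_mem_CSet hl hr hΔ0 hc n)
      (hl _ (Ioo_subset_Icc_self hc.1) n) (hr _ (Ioo_subset_Icc_self hc.1) n)
  induction n with
  | zero =>
    have key : ∀ {c}, c ∈ CSet e l r → l c (e 0) = 0 ∧ r c (e 0) = 1 := fun {c} hc => by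
      obtain ⟨h1, h2, h3, -⟩ := gap hc 0
      rw [hΔ0] at h1 h2
      rcases h1 with h1 | h1 <;> rcases h2 with h2 | h2 <;> simp_all
      linarith
    exact ⟨(key hc).1.trans (key hc').1.symm, (key hc).2.trans (key hc').2.symm⟩
  | succ n ih =>
    obtain ⟨ihl, ihr⟩ := ih fun m hm => h m (hm.trans n.lt_succ_self)
    have hn := h n n.lt_succ_self
    rw [succ_mem_FSet_iff he, succ_mem_FSet_iff he, not_iff_not] at hn
    have g := gap hc (n + 1)
    have g' := gap hc' (n + 1)
    by_cases hs : l c (e n) = l c (e (n + 1))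
    · have hL : l c (e (n + 1)) = l c' (e (n + 1)) := hs.symm.trans (ihl.trans (hn.1 hs))
      exact ⟨hL, g.right_unique (hL ▸ g')⟩
    · have hR : r c (e (n + 1)) = r c' (e (n + 1)) :=
        ((hc.2 n).resolve_left hs).symm.trans
          (ihr.trans ((hc'.2 n).resolve_left fun h => hs (hn.2 h)))
      exact ⟨g.left_unique (hR ▸ g'), hR⟩

theorem left_eq_of_FSet_eq (he : Function.Injective e) (hmono : Monotone Δ)
    (hΔI : ∀ n, Δ n ⊆ Icc 0 1)
    (hl : ∀ c ∈ Icc (0 : ℝ) 1, ∀ n, IsGreatest {x ∈ Δ n | x ≤ c} (l c (e n)))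
    (hr : ∀ c ∈ Icc (0 : ℝ) 1, ∀ n, IsLeast {x ∈ Δ n | c ≤ x} (r c (e n)))
    (hΔ0 : Δ 0 = {0, 1}) {c c' : ℝ} (hc : c ∈ CSet e l r) (hc' : c' ∈ CSet e l r) {n n' : ℕ}
    (hnn : n ≤ n') (h : FSet e l (l c (e n)) = FSet e l (l c' (e n'))) :
    l c (e n) = l c' (e n') := by
  have hI := Ioo_subset_Icc_self hc.1
  have hI' := Ioo_subset_Icc_self hc'.1
  have hF : ∀ m, (m < n ∧ e (m + 1) ∈ FSet e l c) ↔ (m < n' ∧ e (m + 1) ∈ FSet e l c') :=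
    fun m => by
      rw [← succ_mem_FSet_left_iff he hmono hΔI hl hI, h,
        succ_mem_FSet_left_iff he hmono hΔI hl hI']
  rw [(left_right_eq_of_FSet_agree he hl hr hΔ0 hc hc' n fun m hm => by
    simpa [hm, hm.trans_le hnn] using hF m).1]
  have stay : ∀ k, n ≤ k → k ≤ n' → l c' (e n) = l c' (e k) := fun k hk => by
    induction k, hk using Nat.le_induction with
    | base => exact fun _ => rfl
    | succ k hk ih =>
      intro hkn
      rw [ih (Nat.le_of_succ_le hkn)]
      by_contra hne
      exact hk.not_gt ((hF k).2 ⟨hkn, (succ_mem_FSet_iff he).2 hne⟩).1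
  exact stay n' hnn le_rfl

/-- Every infinite, co-infinite pattern of moves is realised by a point of `ASet`. -/
theorem exists_mem_ASet (he : Function.Injective e) (hmono : Monotone Δ)
    (hfin : ∀ n, (Δ n).Finite)
    (hsplit : ∀ n, ∀ a ∈ Δ n, ∀ b ∈ Δ n, a < b → ∃ x ∈ Δ (n + 1), a < x ∧ x < b)
    (hl : ∀ c ∈ Icc (0 : ℝ) 1, ∀ n, IsGreatest {x ∈ Δ n | x ≤ c} (l c (e n)))
    (hr : ∀ c ∈ Icc (0 : ℝ) 1, ∀ n, IsLeast {x ∈ Δ n | c ≤ x} (r c (e n)))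
    (hΔ0 : Δ 0 = {0, 1}) {S : Set ℕ} (hS : S.Infinite) (hS' : Sᶜ.Infinite) :
    ∃ c ∈ ASet e l r, ∀ n, e (n + 1) ∈ FSet e l c ↔ n ∈ S := by
  have h₀ : IsGap (Δ 0) 0 1 := by
    rw [hΔ0]
    refine ⟨by simp, by simp, one_pos, ?_⟩
    rintro x (rfl | rfl) <;> simp
  obtain ⟨a, b, ha, hb, hg, hs, hs'⟩ := exists_nested_gaps hfin hmono hsplit h₀ S
  obtain ⟨c, hc⟩ := exists_mem_Ioo_of_nested (fun n => (hg n).2.2.1) hs hs' hS hS'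
  have hc01 : c ∈ Ioo (0 : ℝ) 1 := by simpa [ha, hb] using hc 0
  have hcI := Ioo_subset_Icc_self hc01
  have hL : ∀ n, l c (e n) = a n := fun n =>
    (hl c hcI n).unique ((hg n).isGreatest (hc n).1.le (hc n).2)
  have hR : ∀ n, r c (e n) = b n := fun n =>
    (hr c hcI n).unique ((hg n).isLeast (hc n).1 (hc n).2.le)
  have hF : ∀ n, e (n + 1) ∈ FSet e l c ↔ n ∈ S := fun n => by
    rw [succ_mem_FSet_iff he, hL, hL]
    by_cases hn : n ∈ S
    · simp [hn, (hs n hn).1.ne]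
    · simp [hn, (hs' n hn).1]
  have hinj : Function.Injective fun n => e (n + 1) := fun m n h => by simpa using he h
  refine ⟨c, ⟨⟨hc01, fun n => ?_⟩, ?_, ?_⟩, hF⟩
  · rw [hL, hL, hR, hR]
    by_cases hn : n ∈ S
    exacts [Or.inr (hs n hn).2.symm, Or.inl (hs' n hn).1.symm]
  · exact (hS.image hinj.injOn).mono (image_subset_iff.2 fun n hn => (hF n).2 hn)
  · exact (hS'.image hinj.injOn).mono
      (image_subset_iff.2 fun n (hn : n ∉ S) => ⟨mem_range_self _, fun h => hn ((hF n).1 h)⟩)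

end FSet

theorem stmt4 (D : Set ℝ) (prec : ℝ → ℝ → Prop)
    (hD : D ⊆ Icc (0:ℝ) 1)
    (hdense : ∀ x ∈ Icc (0:ℝ) 1, x ∈ closure D)
    (h0 : (0:ℝ) ∈ D) (h1 : (1:ℝ) ∈ D)
    (hirr : ∀ d ∈ D, ¬ prec d d)
    (htrans : ∀ a ∈ D, ∀ b ∈ D, ∀ c ∈ D, prec a b → prec b c → prec a c)
    (htri : ∀ a ∈ D, ∀ b ∈ D, a ≠ b → prec a b ∨ prec b a)
    (hfin : ∀ d ∈ D, {x ∈ D | prec x d}.Finite)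
    (hmin : ∀ d ∈ D, d ≠ 1 → prec 1 d)
    (hsucc : prec 1 0 ∧ ∀ d ∈ D, prec 1 d → d = 0 ∨ prec 0 d)
    (e : ℕ → ℝ) (he : ∀ n, e n ∈ D) (he0 : e 0 = 0)
    (hemono : ∀ m n : ℕ, m < n → prec (e m) (e n))
    (hsplit : ∀ m n : ℕ, m < n → SplitsBetween D prec (e m) (e n))
    (l r : ℝ → ℝ → ℝ)
    (hl : ∀ c ∈ Icc (0:ℝ) 1, ∀ d ∈ D, (prec 0 d ∨ d = 0) →
      IsGreatest {x ∈ D | (prec x d ∨ x = d) ∧ x ≤ c} (l c d))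
    (hr : ∀ c ∈ Icc (0:ℝ) 1, ∀ d ∈ D, (prec 0 d ∨ d = 0) →
      IsLeast {x ∈ D | (prec x d ∨ x = d) ∧ c ≤ x} (r c d))
    (X : Set ℝ)
    (hX : X ⊆ range e \ {e 0})
    (hXfin : X.Finite) :
    ∃! d : ℝ, d ∈ BSet D e l r ∧ FSet e l d = X := by
  have hinj : Function.Injective e := fun m n h => by
    rcases lt_trichotomy m n with hmn | hmn | hmn
    · exact absurd (h ▸ hemono m n hmn) (hirr _ (he n))
    · exact hmn
    · exact absurd (h ▸ hemono n m hmn) (hirr _ (he m))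
  let Δ : ℕ → Set ℝ := fun n => {x ∈ D | prec x (e n) ∨ x = e n}
  have hlt : ∀ n, ∀ x ∈ Δ n, prec x (e (n + 1)) := by
    rintro n x ⟨hx, h | rfl⟩
    · exact htrans x hx _ (he n) _ (he _) h (hemono _ _ n.lt_succ_self)
    · exact hemono _ _ n.lt_succ_self
  have hmono : Monotone Δ :=
    monotone_nat_of_le_succ fun n x hx => ⟨hx.1, Or.inl (hlt n x hx)⟩
  have hΔI : ∀ n, Δ n ⊆ Icc 0 1 := fun n x hx => hD hx.1
  have hΔfin : ∀ n, (Δ n).Finite := fun n =>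
    ((hfin (e n) (he n)).insert (e n)).subset fun x hx =>
      hx.2.elim (fun h => Or.inr ⟨hx.1, h⟩) Or.inl
  have hΔ0 : Δ 0 = {0, 1} := by
    ext x
    constructor
    · rintro ⟨hx, h⟩
      rw [he0] at h
      rcases h with h | rfl
      · right
        by_contra hx1
        rcases hsucc.2 x hx (hmin x hx hx1) with rfl | h'
        · exact hirr _ hx h
        · exact hirr _ h0 (htrans _ h0 _ hx _ h0 h' h)
      · exact Or.inl rfl
    · rintro (rfl | rfl)
      · exact ⟨h0, Or.inr he0.symm⟩
      · exact ⟨h1, Or.inl (he0 ▸ hsucc.1)⟩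
  have hΔsplit : ∀ n, ∀ a ∈ Δ n, ∀ b ∈ Δ n, a < b → ∃ x ∈ Δ (n + 1), a < x ∧ x < b := by
    intro n a ha b hb hab
    obtain ⟨x, hx, -, hxn, hax, hxb⟩ :=
      hsplit n (n + 1) n.lt_succ_self a ha.1 b hb.1 hab ha.2 hb.2
    exact ⟨x, ⟨hx, Or.inl hxn⟩, hax, hxb⟩
  have he_ge : ∀ n, prec 0 (e n) ∨ e n = 0 := fun n => by
    rcases n.eq_zero_or_pos with rfl | hn
    · exact Or.inr he0
    · exact Or.inl (he0 ▸ hemono 0 n hn)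
  have hl' : ∀ c ∈ Icc (0 : ℝ) 1, ∀ n, IsGreatest {x ∈ Δ n | x ≤ c} (l c (e n)) :=
    fun c hc n => by
      simpa only [Δ, mem_ofPred_eq, and_assoc] using hl c hc (e n) (he n) (he_ge n)
  have hr' : ∀ c ∈ Icc (0 : ℝ) 1, ∀ n, IsLeast {x ∈ Δ n | c ≤ x} (r c (e n)) :=
    fun c hc n => by
      simpa only [Δ, mem_ofPred_eq, and_assoc] using hr c hc (e n) (he n) (he_ge n)
  refine existsUnique_of_exists_of_unique ?_ ?_
  · obtain ⟨N, hN⟩ := (hXfin.preimage (hinj.comp Nat.succ_injective).injOn).bddAbove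
    let S : Set ℕ := {n | e (n + 1) ∈ X ∨ N < n ∧ Even n}
    have hS : S.Infinite := infinite_of_forall_exists_gt fun n =>
      ⟨2 * (n + N + 1), Or.inr ⟨by omega, even_two_mul _⟩, by omega⟩
    have hS' : Sᶜ.Infinite := infinite_of_forall_exists_gt fun n => by
      refine ⟨2 * (n + N) + 1, ?_, by omega⟩
      rintro (h | h)
      · have := hN h
        omega
      · exact Nat.not_even_two_mul_add_one _ h.2
    obtain ⟨c, hc, hF⟩ :=
      exists_mem_ASet (r := r) hinj hmono hΔfin hΔsplit hl' hr' hΔ0 hS hS'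
    have hcI := Ioo_subset_Icc_self hc.1.1
    have key : ∀ n, e (n + 1) ∈ FSet e l (l c (e (N + 1))) ↔ e (n + 1) ∈ X := fun n => by
      rw [succ_mem_FSet_left_iff hinj hmono hΔI hl' hcI, hF]
      constructor
      · rintro ⟨hn, h | h⟩
        · exact h
        · omega
      · exact fun h => ⟨Nat.lt_succ_of_le (hN h), Or.inl h⟩
    refine ⟨l c (e (N + 1)), ⟨(hl' c hcI _).1.1.1, c, hc, _, rfl⟩, Subset.antisymm ?_ ?_⟩
    · intro x hx
      obtain ⟨n, rfl, -⟩ := id hx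
      exact (key n).1 hx
    · intro x hx
      obtain ⟨⟨_ | n, rfl⟩, hn⟩ := hX hx
      · exact absurd rfl hn
      · exact (key n).2 hx
  · rintro _ _ ⟨⟨-, c, hc, n, rfl⟩, h⟩ ⟨⟨-, c', hc', n', rfl⟩, h'⟩
    rcases le_total n n' with hn | hn
    · exact left_eq_of_FSet_eq hinj hmono hΔI hl' hr' hΔ0 hc.1 hc'.1 hn (h.trans h'.symm)
    · exact (left_eq_of_FSet_eq hinj hmono hΔI hl' hr' hΔ0 hc'.1 hc.1 hn (h'.trans h.symm)).symm
end

section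
/- Let (u₁,v₁) and (u₂,v₂) be two distinct bounded connected components of ℝ∖K with v₁ ≤ u₂. Then v₁ < u₂, and there is a bounded connected component (u₃,v₃) of ℝ∖K with v₁ < u₃ and v₃ < u₂ (i.e., between any two complementary intervals of K there is a third). -/
open Set

/-- A Cantor set: a nonempty compact subset of `ℝ` with no isolated points and
empty interior. -/
def IsCantorSet (K : Set ℝ) : Prop :=
  K.Nonempty ∧ IsCompact K ∧ (∀ x ∈ K, x ∈ closure (K \ {x})) ∧ interior K = ∅

/-- For a closed set `K ⊆ ℝ`, `Ioo u v` is a bounded connected component of `ℝ \ K`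
(a bounded complementary interval of `K`) iff `u < v`, `Ioo u v` misses `K`, and
both endpoints belong to `K`. -/
def IsBddCompInterval (K : Set ℝ) (u v : ℝ) : Prop :=
  u < v ∧ Ioo u v ∩ K = ∅ ∧ u ∈ K ∧ v ∈ K

/-- The set of right endpoints of bounded complementary intervals of `K`. -/
def rightEndpoints (K : Set ℝ) : Set ℝ :=
  {v | ∃ u, IsBddCompInterval K u v}

theorem IsCantorSet.exists_mem_Ioo_ne {K : Set ℝ} (hK : IsCantorSet K) {x l r : ℝ} (hx : x ∈ K)
    (hl : l < x) (hr : x < r) : ∃ a ∈ K, a ≠ x ∧ l < a ∧ a < r := by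
  obtain ⟨a, ⟨hla, har⟩, haK, hax⟩ :=
    mem_closure_iff.1 (hK.2.2.1 x hx) (Ioo l r) isOpen_Ioo ⟨hl, hr⟩
  exact ⟨a, haK, hax, hla, har⟩

theorem IsBddCompInterval.le_or_le {K : Set ℝ} {u v x : ℝ} (h : IsBddCompInterval K u v)
    (hx : x ∈ K) : x ≤ u ∨ v ≤ x := by
  by_contra! hux
  exact h.2.1.subset ⟨hux, hx⟩

theorem IsCantorSet.exists_isBddCompInterval {K : Set ℝ} (hK : IsCantorSet K) {a b : ℝ}
    (ha : a ∈ K) (hb : b ∈ K) (hab : a < b) :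
    ∃ u v, IsBddCompInterval K u v ∧ a ≤ u ∧ v ≤ b := by
  obtain ⟨c, ⟨hac, hcb⟩, hcK⟩ : ∃ c ∈ Ioo a b, c ∉ K := by
    by_contra! h
    have hsub : Ioo a b ⊆ interior K := interior_maximal h isOpen_Ioo
    rw [hK.2.2.2] at hsub
    obtain ⟨c, hc⟩ := nonempty_Ioo.2 hab
    exact hsub hc
  obtain ⟨u, ⟨huK, hau, huc⟩, hu⟩ :=
    (hK.2.1.inter_right isClosed_Icc).exists_isGreatest ⟨a, ha, le_refl a, hac.le⟩
  obtain ⟨v, ⟨hvK, hcv, hvb⟩, hv⟩ :=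
    (hK.2.1.inter_right isClosed_Icc).exists_isLeast ⟨b, hb, hcb.le, le_refl b⟩
  have huc' : u < c := huc.lt_of_ne fun h => hcK (h ▸ huK)
  refine ⟨u, v, ⟨huc'.trans_le hcv, ?_, huK, hvK⟩, hau, hvb⟩
  refine eq_empty_of_forall_notMem ?_
  rintro x ⟨⟨hux, hxv⟩, hxK⟩
  rcases le_total x c with hxc | hcx
  · exact (hu ⟨hxK, hau.trans hux.le, hxc⟩).not_gt hux
  · exact (hv ⟨hxK, hcx, hxv.le.trans hvb⟩).not_gt hxv

theorem stmt5 (K : Set ℝ) (hK : IsCantorSet K) (u₁ v₁ u₂ v₂ : ℝ)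
    (h1 : IsBddCompInterval K u₁ v₁) (h2 : IsBddCompInterval K u₂ v₂)
    (hne : (u₁, v₁) ≠ (u₂, v₂)) (hle : v₁ ≤ u₂) :
    v₁ < u₂ ∧ ∃ u₃ v₃, IsBddCompInterval K u₃ v₃ ∧ v₁ < u₃ ∧ v₃ < u₂ := by
  have hlt : v₁ < u₂ := by
    refine hle.lt_of_ne ?_
    rintro rfl
    obtain ⟨a, haK, hav, hua, hav₂⟩ := hK.exists_mem_Ioo_ne h1.2.2.2 h1.1 h2.1
    rcases h1.le_or_le haK with h | h
    · exact h.not_gt hua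
    rcases h2.le_or_le haK with h' | h'
    · exact hav (h'.antisymm h)
    · exact h'.not_gt hav₂
  obtain ⟨a, haK, hav, hua, hau⟩ := hK.exists_mem_Ioo_ne h1.2.2.2 h1.1 hlt
  have hva : v₁ < a := ((h1.le_or_le haK).resolve_left hua.not_ge).lt_of_ne' hav
  obtain ⟨b, hbK, hbu, hab, hbv⟩ := hK.exists_mem_Ioo_ne h2.2.2.1 hau h2.1
  have hbu' : b < u₂ := ((h2.le_or_le hbK).resolve_right hbv.not_ge).lt_of_ne hbu
  obtain ⟨u, v, huv, hau', hvb⟩ := hK.exists_isBddCompInterval haK hbK hab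
  exact ⟨hlt, u, v, huv, hva.trans_le hau', hvb.trans_lt hbu'⟩
end

section
/- C is dense in C∪L with respect to the order <, i.e., for all a < b in C∪L there is c ∈ C with a ≤ c ≤ b and a < c or c < b witnessing density (in fact for all a < b in C∪L there is c ∈ C with a < c < b); (C∪L,<) is a dense linear order without least or greatest element which has the least-upper-bound property (every nonempty subset bounded above has a supremum in C∪L); and there exists an order isomorphism from (C∪L,<) onto (ℝ,<). -/
open Set

/-- `L`: the set of points of `K` lying in the closure of no connected component
of `ℝ \ K`. -/
def cantorL (K : Set ℝ) : Set ℝ :=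
  {x ∈ K | ∀ y, y ∉ K → x ∉ closure (connectedComponentIn Kᶜ y)}

theorem nonempty_orderIso_real_of_countable_dense {X : Type*} [LinearOrder X] [Nonempty X]
    [NoMinOrder X] [NoMaxOrder X] (D : Set X) (hD : D.Countable)
    (hdense : ∀ a b : X, a < b → ∃ c ∈ D, a < c ∧ c < b)
    (hlub : ∀ T : Set X, T.Nonempty → BddAbove T → ∃ x, IsLUB T x) :
    Nonempty (X ≃o ℝ) := by
  have hbelow : ∀ x : X, ∃ c ∈ D, c < x := fun x ↦ by
    obtain ⟨y, hy⟩ := exists_lt x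
    obtain ⟨c, hc, -, h⟩ := hdense y x hy
    exact ⟨c, hc, h⟩
  have habove : ∀ x : X, ∃ c ∈ D, x < c := fun x ↦ by
    obtain ⟨y, hy⟩ := exists_gt x
    obtain ⟨c, hc, h, -⟩ := hdense x y hy
    exact ⟨c, hc, h⟩
  have : Countable D := hD.to_subtype
  have : Nonempty D := by
    obtain ⟨c, hc, -⟩ := hbelow (Classical.arbitrary X)
    exact ⟨⟨c, hc⟩⟩
  have : DenselyOrdered D := ⟨fun a b hab ↦ by
    obtain ⟨c, hc, h⟩ := hdense a b hab
    exact ⟨⟨c, hc⟩, h⟩⟩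
  have : NoMinOrder D := ⟨fun a ↦ by
    obtain ⟨c, hc, h⟩ := hbelow a
    exact ⟨⟨c, hc⟩, h⟩⟩
  have : NoMaxOrder D := ⟨fun a ↦ by
    obtain ⟨c, hc, h⟩ := habove a
    exact ⟨⟨c, hc⟩, h⟩⟩
  obtain ⟨e⟩ := Order.iso_of_countable_dense D ℚ
  let A : X → Set ℝ := fun x ↦ (fun c : D ↦ (e c : ℝ)) '' {c | (c : X) < x}
  have hA_lt : ∀ (x : X) (d : D), x ≤ d → ∀ r ∈ A x, r ≤ e d := by
    rintro x d hxd _ ⟨c, hc, rfl⟩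
    have : c < d := (show (c : X) < x from hc).trans_le hxd
    exact Rat.cast_le.2 (e.lt_iff_lt.2 this).le
  have hA_ne : ∀ x, (A x).Nonempty := fun x ↦ by
    obtain ⟨c, hc, h⟩ := hbelow x
    exact ⟨_, ⟨c, hc⟩, h, rfl⟩
  have hA_bdd : ∀ x, BddAbove (A x) := fun x ↦ by
    obtain ⟨c, hc, h⟩ := habove x
    exact ⟨_, hA_lt x ⟨c, hc⟩ h.le⟩
  have hle : ∀ (x : X) (d : D), x ≤ d → sSup (A x) ≤ e d := fun x d h ↦
    csSup_le (hA_ne x) (hA_lt x d h)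
  have hge : ∀ (x : X) (d : D), (d : X) < x → (e d : ℝ) ≤ sSup (A x) := fun x d h ↦
    le_csSup (hA_bdd x) ⟨d, h, rfl⟩
  have hmono : StrictMono fun x ↦ sSup (A x) := fun x y hxy ↦ by
    obtain ⟨c, hc, hxc, hcy⟩ := hdense x y hxy
    obtain ⟨d, hd, hcd, hdy⟩ := hdense c y hcy
    have hcd' : (⟨c, hc⟩ : D) < ⟨d, hd⟩ := hcd
    calc sSup (A x) ≤ e ⟨c, hc⟩ := hle x ⟨c, hc⟩ hxc.le
      _ < e ⟨d, hd⟩ := by exact_mod_cast e.lt_iff_lt.2 hcd'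
      _ ≤ sSup (A y) := hge y ⟨d, hd⟩ hdy
  have hsurj : Function.Surjective fun x ↦ sSup (A x) := fun r ↦ by
    obtain ⟨x, hx⟩ := hlub ((↑) '' {c : D | (e c : ℝ) < r}) (by
        obtain ⟨q, hq⟩ := exists_rat_lt r
        exact ⟨_, e.symm q, by simpa using hq, rfl⟩) (by
        obtain ⟨q, hq⟩ := exists_rat_gt r
        refine ⟨e.symm q, ?_⟩
        rintro _ ⟨c, hc, rfl⟩
        have : e c < q := by exact_mod_cast (show (e c : ℝ) < r from hc).trans hq
        exact (e.lt_symm_apply.2 this).le)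
    refine ⟨x, le_antisymm (csSup_le (hA_ne x) ?_) (le_of_forall_lt fun s hs ↦ ?_)⟩
    · rintro _ ⟨c, hc, rfl⟩
      obtain ⟨_, ⟨d, hd, rfl⟩, hcd, -⟩ := hx.exists_between hc
      have : (e c : ℝ) < e d := by exact_mod_cast e.lt_iff_lt.2 (show c < d from hcd)
      exact (this.trans hd).le
    · obtain ⟨q, hsq, hqr⟩ := exists_rat_btwn hs
      obtain ⟨q', hqq', hqr'⟩ := exists_rat_btwn hqr
      have h₁ : ((e.symm q' : D) : X) ≤ x := hx.1 ⟨e.symm q', by simpa using hqr', rfl⟩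
      have h₂ : e.symm q < e.symm q' := e.symm.lt_iff_lt.2 (by exact_mod_cast hqq')
      have h₃ := hge x (e.symm q) (lt_of_lt_of_le h₂ h₁)
      rw [e.apply_symm_apply] at h₃
      exact hsq.trans_le h₃
  exact ⟨hmono.orderIsoOfSurjective _ hsurj⟩

section CantorSet

variable {K : Set ℝ}

theorem countable_rightEndpoints (K : Set ℝ) : (rightEndpoints K).Countable := by
  refine (countable_setOfPred_isolated_left_within (s := K)).mono ?_
  rintro v ⟨u, huv, hgap, -, hv⟩
  refine ⟨hv, Filter.empty_mem_iff_bot.1 ?_⟩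
  filter_upwards [self_mem_nhdsWithin, mem_nhdsWithin_of_mem_nhds (Ioi_mem_nhds huv)] with z hz huz
  exact hgap ▸ (⟨⟨huz, hz.2⟩, hz.1⟩ : z ∈ Ioo u v ∩ K)

theorem mem_rightEndpoints_of_gap (hK : IsCompact K) {m x y : ℝ} (hm : m ∈ K) (hx : x ∈ K)
    (hmx : m < x) (hyx : y < x) (hgap : ∀ z ∈ K, y < z → x ≤ z) : x ∈ rightEndpoints K := by
  have hmy : m ≤ y := not_lt.1 fun h ↦ (hgap m hm h).not_gt hmx
  obtain ⟨u, hu⟩ := (hK.inter_right isClosed_Iic).exists_isGreatest ⟨m, hm, hmy⟩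
  refine ⟨u, lt_of_le_of_lt hu.1.2 hyx, ?_, hu.1.1, hx⟩
  refine eq_empty_of_forall_notMem fun z ⟨⟨h₁, h₂⟩, hz⟩ ↦ ?_
  rcases le_or_gt z y with h | h
  · exact (hu.2 ⟨hz, h⟩).not_gt h₁
  · exact (hgap z hz h).not_gt h₂

theorem exists_mem_rightEndpoints_of_notMem (hK : IsCompact K) {p z q : ℝ} (hp : p ∈ K)
    (hq : q ∈ K) (hz : z ∉ K) (hpz : p < z) (hzq : z ≤ q) :
    ∃ c ∈ rightEndpoints K, z < c ∧ c ≤ q ∧ ∀ k ∈ K, z ≤ k → c ≤ k := by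
  obtain ⟨v, hv⟩ := (hK.inter_right isClosed_Ici).exists_isLeast ⟨q, hq, hzq⟩
  have hzv : z < v := lt_of_le_of_ne hv.1.2 fun h ↦ hz (h ▸ hv.1.1)
  exact ⟨v, mem_rightEndpoints_of_gap hK hp hv.1.1 (hpz.trans hzv) hzv
    fun k hk h ↦ hv.2 ⟨hk, h.le⟩, hzv, hv.2 ⟨hq, hzq⟩, fun k hk h ↦ hv.2 ⟨hk, h⟩⟩

theorem IsCantorSet.exists_mem_rightEndpoints (hK : IsCantorSet K) {p q : ℝ} (hp : p ∈ K)
    (hq : q ∈ K) (hpq : p < q) : ∃ c ∈ rightEndpoints K, p < c ∧ c ≤ q := by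
  obtain ⟨z, hz, hzK⟩ : ∃ z ∈ Ioo p q, z ∉ K := by
    by_contra! h
    obtain ⟨z, hz⟩ := nonempty_Ioo.2 hpq
    have : z ∈ interior K := interior_maximal h isOpen_Ioo hz
    rw [hK.2.2.2] at this
    exact this
  obtain ⟨c, hc, hzc, hcq, -⟩ := exists_mem_rightEndpoints_of_notMem hK.2.1 hp hq hzK hz.1 hz.2.le
  exact ⟨c, hc, hz.1.trans hzc, hcq⟩

theorem IsCantorSet.exists_mem_near (hK : IsCantorSet K) {a x b : ℝ} (hx : x ∈ K)
    (hax : a < x) (hxb : x < b) : ∃ k ∈ K, k ≠ x ∧ a < k ∧ k < b := by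
  obtain ⟨k, hk, hkK, hkx⟩ := mem_closure_iff.1 (hK.2.2.1 x hx) _ isOpen_Ioo ⟨hax, hxb⟩
  exact ⟨k, hkK, hkx, hk⟩

theorem notMem_cantorL_of_isPreconnected {x : ℝ} {s : Set ℝ} (hs : IsPreconnected s)
    (hne : s.Nonempty) (hsK : s ⊆ Kᶜ) (hx : x ∈ closure s) : x ∉ cantorL K := fun h ↦ by
  obtain ⟨y, hy⟩ := hne
  exact h.2 y (hsK hy) (closure_mono (hs.subset_connectedComponentIn hy hsK) hx)

/-- The points of `C ∪ L` are the points of `K` other than its minimum that are limits of `K`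
from the right. -/
theorem IsCantorSet.mem_union_iff (hK : IsCantorSet K) {m : ℝ} (hm : IsLeast K m) {x : ℝ} :
    x ∈ rightEndpoints K ∪ cantorL K ↔
      x ∈ K ∧ m < x ∧ ∀ y, x < y → ∃ k ∈ K, x < k ∧ k < y := by
  constructor
  · rintro (⟨u, hux, hgap, hu, hx⟩ | hx)
    · refine ⟨hx, (hm.2 hu).trans_lt hux, fun y hxy ↦ ?_⟩
      obtain ⟨k, hk, hkx, huk, hky⟩ := hK.exists_mem_near hx hux hxy
      refine ⟨k, hk, lt_of_not_ge fun h ↦ ?_, hky⟩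
      exact (hgap ▸ (⟨⟨huk, lt_of_le_of_ne h hkx⟩, hk⟩ : k ∈ Ioo u x ∩ K) : k ∈ (∅ : Set ℝ))
    · refine ⟨hx.1, lt_of_le_of_ne (hm.2 hx.1) ?_, fun y hxy ↦ ?_⟩
      · rintro rfl
        exact notMem_cantorL_of_isPreconnected isPreconnected_Iio nonempty_Iio
          (fun z hz hzK ↦ (hm.2 hzK).not_gt hz) (by simp) hx
      · by_contra! h
        exact notMem_cantorL_of_isPreconnected isPreconnected_Ioo (nonempty_Ioo.2 hxy)
          (fun z hz hzK ↦ (h z hzK hz.1).not_gt hz.2)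
          (by rw [closure_Ioo hxy.ne]; exact ⟨le_rfl, hxy.le⟩) hx
  · rintro ⟨hx, hmx, hright⟩
    by_cases hL : x ∈ cantorL K
    · exact Or.inr hL
    left
    obtain ⟨y, hy, hcl⟩ : ∃ y, y ∉ K ∧ x ∈ closure (connectedComponentIn Kᶜ y) := by
      by_contra! h
      exact hL ⟨hx, h⟩
    have hsub := connectedComponentIn_subset Kᶜ y
    have hyc := mem_connectedComponentIn (F := Kᶜ) hy
    have hord : OrdConnected (connectedComponentIn Kᶜ y) :=
      isPreconnected_connectedComponentIn.ordConnected
    rcases lt_trichotomy y x with hyx | rfl | hxy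
    · refine mem_rightEndpoints_of_gap hK.2.1 hm.1 hx hmx hyx fun z hz hyz ↦ le_of_not_gt fun hzx ↦ ?_
      obtain ⟨w, hzw, hw⟩ := mem_closure_iff.1 hcl _ isOpen_Ioi hzx
      exact hsub (hord.out hyc hw ⟨hyz.le, le_of_lt hzw⟩) hz
    · exact absurd hx hy
    · obtain ⟨k, hk, hxk, hky⟩ := hright y hxy
      obtain ⟨w, hwk, hw⟩ := mem_closure_iff.1 hcl _ isOpen_Iio hxk
      exact absurd hk (hsub (hord.out hw hyc ⟨le_of_lt hwk, hky.le⟩))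

theorem IsCantorSet.exists_least_upper_bound (hK : IsCantorSet K) {m : ℝ} (hm : IsLeast K m)
    {T : Set ℝ} (hT : T ⊆ rightEndpoints K ∪ cantorL K) (hne : T.Nonempty)
    (hb : ∃ b ∈ rightEndpoints K ∪ cantorL K, ∀ t ∈ T, t ≤ b) :
    ∃ x ∈ rightEndpoints K ∪ cantorL K, (∀ t ∈ T, t ≤ x) ∧
      ∀ y ∈ rightEndpoints K ∪ cantorL K, (∀ t ∈ T, t ≤ y) → x ≤ y := by
  have hmem := fun x ↦ hK.mem_union_iff hm (x := x)
  obtain ⟨b, hbS, hbT⟩ := hb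
  have hlub : IsLUB T (sSup T) := isLUB_csSup hne ⟨b, hbT⟩
  set s := sSup T
  have hsK : s ∈ K :=
    closure_minimal (fun t ht ↦ ((hmem t).1 (hT ht)).1) hK.2.1.isClosed (hlub.mem_closure hne)
  have hms : m < s := by
    obtain ⟨t, ht⟩ := hne
    exact ((hmem t).1 (hT ht)).2.1.trans_le (hlub.1 ht)
  by_cases hright : ∀ y, s < y → ∃ k ∈ K, s < k ∧ k < y
  · exact ⟨s, (hmem s).2 ⟨hsK, hms, hright⟩, hlub.1, fun y _ hy ↦ hlub.2 hy⟩
  have hgt : ∀ y ∈ rightEndpoints K ∪ cantorL K, (∀ t ∈ T, t ≤ y) → s < y := fun y hy h ↦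
    lt_of_le_of_ne (hlub.2 h) fun hsy ↦ hright (hsy ▸ ((hmem y).1 hy).2.2)
  push Not at hright
  obtain ⟨y, hsy, hgap⟩ := hright
  obtain ⟨z, hsz, hzy⟩ := exists_between hsy
  have hz : z ∉ K := fun h ↦ (hgap z h hsz).not_gt hzy
  obtain ⟨c, hc, hzc, -, hleast⟩ := exists_mem_rightEndpoints_of_notMem hK.2.1 hsK
    ((hmem b).1 hbS).1 hz hsz
    (hzy.le.trans (hgap b ((hmem b).1 hbS).1 (hgt b hbS hbT)))
  refine ⟨c, Or.inl hc, fun t ht ↦ (hlub.1 ht).trans (hsz.trans hzc).le, fun w hw hwT ↦ ?_⟩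
  have hwK := ((hmem w).1 hw).1
  exact hleast w hwK (hzy.le.trans (hgap w hwK (hgt w hw hwT)))

end CantorSet

theorem stmt7 (K : Set ℝ) (hK : IsCantorSet K) :
    (∀ a ∈ rightEndpoints K ∪ cantorL K, ∀ b ∈ rightEndpoints K ∪ cantorL K,
      a < b → ∃ c ∈ rightEndpoints K, a < c ∧ c < b) ∧
    (∀ a ∈ rightEndpoints K ∪ cantorL K, ∃ b ∈ rightEndpoints K ∪ cantorL K, b < a) ∧
    (∀ a ∈ rightEndpoints K ∪ cantorL K, ∃ b ∈ rightEndpoints K ∪ cantorL K, a < b) ∧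
    (∀ T ⊆ rightEndpoints K ∪ cantorL K, T.Nonempty →
      (∃ b ∈ rightEndpoints K ∪ cantorL K, ∀ t ∈ T, t ≤ b) →
      ∃ x ∈ rightEndpoints K ∪ cantorL K, (∀ t ∈ T, t ≤ x) ∧
        ∀ y ∈ rightEndpoints K ∪ cantorL K, (∀ t ∈ T, t ≤ y) → x ≤ y) ∧
    Nonempty (↥(rightEndpoints K ∪ cantorL K) ≃o ℝ) := by
  obtain ⟨m, hm⟩ := hK.2.1.exists_isLeast hK.1
  have hmem := fun x ↦ hK.mem_union_iff hm (x := x)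
  have hdense : ∀ a ∈ rightEndpoints K ∪ cantorL K, ∀ b ∈ rightEndpoints K ∪ cantorL K,
      a < b → ∃ c ∈ rightEndpoints K, a < c ∧ c < b := fun a ha b _ hab ↦ by
    obtain ⟨haK, -, hright⟩ := (hmem a).1 ha
    obtain ⟨k, hk, hak, hkb⟩ := hright b hab
    obtain ⟨c, hc, hac, hck⟩ := hK.exists_mem_rightEndpoints haK hk hak
    exact ⟨c, hc, hac, hck.trans_lt hkb⟩
  have hmin : ∀ a ∈ rightEndpoints K ∪ cantorL K,
      ∃ b ∈ rightEndpoints K ∪ cantorL K, b < a := fun a ha ↦ by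
    obtain ⟨k, hk, hkm, -, hka⟩ := hK.exists_mem_near hm.1 (sub_one_lt m) ((hmem a).1 ha).2.1
    obtain ⟨c, hc, -, hck⟩ :=
      hK.exists_mem_rightEndpoints hm.1 hk (lt_of_le_of_ne (hm.2 hk) hkm.symm)
    exact ⟨c, Or.inl hc, hck.trans_lt hka⟩
  have hmax : ∀ a ∈ rightEndpoints K ∪ cantorL K,
      ∃ b ∈ rightEndpoints K ∪ cantorL K, a < b := fun a ha ↦ by
    obtain ⟨haK, -, hright⟩ := (hmem a).1 ha
    obtain ⟨k, hk, hak, -⟩ := hright (a + 1) (lt_add_one a)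
    obtain ⟨c, hc, hac, -⟩ := hK.exists_mem_rightEndpoints haK hk hak
    exact ⟨c, Or.inl hc, hac⟩
  refine ⟨hdense, hmin, hmax, fun T hT hne hb ↦ hK.exists_least_upper_bound hm hT hne hb, ?_⟩
  have : Nonempty ↥(rightEndpoints K ∪ cantorL K) := by
    obtain ⟨k, hk, hkm, -⟩ := hK.exists_mem_near hm.1 (sub_one_lt m) (lt_add_one m)
    obtain ⟨c, hc, -⟩ := hK.exists_mem_rightEndpoints hm.1 hk (lt_of_le_of_ne (hm.2 hk) hkm.symm)
    exact ⟨⟨c, Or.inl hc⟩⟩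
  have : NoMinOrder ↥(rightEndpoints K ∪ cantorL K) := ⟨fun a ↦ by
    obtain ⟨b, hb, h⟩ := hmin a a.2
    exact ⟨⟨b, hb⟩, h⟩⟩
  have : NoMaxOrder ↥(rightEndpoints K ∪ cantorL K) := ⟨fun a ↦ by
    obtain ⟨b, hb, h⟩ := hmax a a.2
    exact ⟨⟨b, hb⟩, h⟩⟩
  refine nonempty_orderIso_real_of_countable_dense ((↑) ⁻¹' rightEndpoints K)
    ((countable_rightEndpoints K).preimage Subtype.val_injective) (fun a b hab ↦ ?_)
    fun T hne ⟨b, hb⟩ ↦ ?_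
  · obtain ⟨c, hc, h⟩ := hdense a a.2 b b.2 hab
    exact ⟨⟨c, Or.inl hc⟩, hc, h⟩
  · obtain ⟨x, hx, hub, hleast⟩ := hK.exists_least_upper_bound hm (T := (↑) '' T)
      (by rintro _ ⟨t, -, rfl⟩; exact t.2) (hne.image _)
      ⟨b, b.2, by rintro _ ⟨t, ht, rfl⟩; exact hb ht⟩
    refine ⟨⟨x, hx⟩, fun t ht ↦ hub t ⟨t, ht, rfl⟩, fun y hy ↦ hleast y y.2 ?_⟩
    rintro _ ⟨t, ht, rfl⟩
    exact hy ht
end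

section
/- Let I₀ = (a,b) be a bounded open interval, let f : [a,b] → ℝ be continuous, and let P := f((a,b)). For p ∈ P let g(p) := min{x ∈ [a,b] : f(x) = p} (this minimum exists since f is continuous and [a,b] is compact). Then for every ε > 0 and every nonempty open interval J ⊆ P, there exist p ∈ J and δ > 0 such that |g(q) − g(p)| < ε for all q ∈ J with |q − p| < δ. In other words, there is no ε > 0 and nonempty open interval J ⊆ P such that g has oscillation at least ε at every point of J (relative to J). -/
open Set

/-- A monotone or antitone function on a nonempty open interval is continuous somewhere in it. -/
lemma exists_continuousAt_of_monotoneOn_or_antitoneOn {g : ℝ → ℝ} {c d : ℝ} (hcd : c < d)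
    (h : MonotoneOn g (Ioo c d) ∨ AntitoneOn g (Ioo c d)) :
    ∃ p ∈ Ioo c d, ContinuousAt g p := by
  have hcount : {x ∈ Ioo c d | ¬ContinuousWithinAt g (Ioo c d) x}.Countable :=
    h.elim (fun h => h.countable_not_continuousWithinAt)
      (fun h => h.countable_not_continuousWithinAt)
  by_contra! hcon
  have hsub : Ioo c d ⊆ {x ∈ Ioo c d | ¬ContinuousWithinAt g (Ioo c d) x} := fun x hx =>
    ⟨hx, fun hx' => hcon x hx (hx'.continuousAt (isOpen_Ioo.mem_nhds hx))⟩
  exact hcd.not_ge (Cardinal.Real.Ioo_countable_iff.1 (hcount.mono hsub))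

/-- The least preimage is monotone in the value above the initial value `f a`. -/
lemma monotoneOn_of_isLeast_preimage {a b c d : ℝ} {f g : ℝ → ℝ}
    (hf : ContinuousOn f (Icc a b)) (hac : f a ≤ c)
    (hg : ∀ p ∈ Ioo c d, IsLeast {x ∈ Icc a b | f x = p} (g p)) :
    MonotoneOn g (Ioo c d) := by
  intro p hp q hq hpq
  obtain ⟨⟨hgq, hfq⟩, -⟩ := hg q hq
  obtain ⟨x, hx, hfx⟩ := intermediate_value_Icc hgq.1
    (hf.mono (Icc_subset_Icc_right hgq.2)) ⟨hac.trans hp.1.le, hpq.trans_eq hfq.symm⟩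
  exact ((hg p hp).2 ⟨⟨hx.1, hx.2.trans hgq.2⟩, hfx⟩).trans hx.2

/-- The least preimage is antitone in the value below the initial value `f a`. -/
lemma antitoneOn_of_isLeast_preimage {a b c d : ℝ} {f g : ℝ → ℝ}
    (hf : ContinuousOn f (Icc a b)) (hda : d ≤ f a)
    (hg : ∀ p ∈ Ioo c d, IsLeast {x ∈ Icc a b | f x = p} (g p)) :
    AntitoneOn g (Ioo c d) := by
  intro q hq p hp hqp
  obtain ⟨⟨hgq, hfq⟩, -⟩ := hg q hq
  obtain ⟨x, hx, hfx⟩ := intermediate_value_Icc' hgq.1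
    (hf.mono (Icc_subset_Icc_right hgq.2)) ⟨hfq.trans_le hqp, hp.2.le.trans hda⟩
  exact ((hg p hp).2 ⟨⟨hx.1, hx.2.trans hgq.2⟩, hfx⟩).trans hx.2

theorem stmt14 (a b : ℝ) (hab : a < b) (f g : ℝ → ℝ)
    (hf : ContinuousOn f (Icc a b))
    (hg : ∀ p ∈ f '' Ioo a b, IsLeast {x ∈ Icc a b | f x = p} (g p)) :
    ∀ ε : ℝ, 0 < ε → ∀ c d : ℝ, c < d → Ioo c d ⊆ f '' Ioo a b →
      ∃ p ∈ Ioo c d, ∃ δ > 0, ∀ q ∈ Ioo c d, |q - p| < δ → |g q - g p| < ε := by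
  intro ε hε c d hcd hsub
  obtain ⟨p, hp, hcont⟩ : ∃ p ∈ Ioo c d, ContinuousAt g p := by
    rcases lt_or_ge (f a) d with had | had
    · have hJ : Ioo (max c (f a)) d ⊆ Ioo c d := Ioo_subset_Ioo_left (le_max_left _ _)
      obtain ⟨p, hp, hcont⟩ := exists_continuousAt_of_monotoneOn_or_antitoneOn (max_lt hcd had)
        (.inl (monotoneOn_of_isLeast_preimage hf (le_max_right _ _)
          fun p hp => hg p (hsub (hJ hp))))
      exact ⟨p, hJ hp, hcont⟩
    · exact exists_continuousAt_of_monotoneOn_or_antitoneOn hcd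
        (.inr (antitoneOn_of_isLeast_preimage hf had fun p hp => hg p (hsub hp)))
  obtain ⟨δ, hδ, h⟩ := Metric.continuousAt_iff.1 hcont ε hε
  exact ⟨p, hp, δ, hδ, fun q _ hq => h hq⟩
end

section
/- Let I ⊆ ℝ be an open interval and f : I → ℝ a continuous function. Assume that every nonempty open subinterval of I contains a nonempty open subinterval on which f is strictly increasing, strictly decreasing, or constant. Then there exists an open set U ⊆ I, dense in I, such that on each connected component of U the function f is strictly increasing, strictly decreasing, or constant. -/
open Set

/-- A family of sets contains a maximal pairwise disjoint subfamily. -/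
theorem exists_maximal_pairwiseDisjoint {X : Type*} (B : Set (Set X)) :
    ∃ F : Set (Set X), Maximal (fun G => G ⊆ B ∧ G.PairwiseDisjoint id) F := by
  refine zorn_subset {G | G ⊆ B ∧ G.PairwiseDisjoint id} fun c hc hchain => ?_
  refine ⟨⋃₀ c, ⟨sUnion_subset fun G hG => (hc hG).1, ?_⟩, fun G hG => subset_sUnion_of_mem hG⟩
  exact (pairwiseDisjoint_sUnion hchain.directedOn).2 fun G hG => (hc hG).2

/-- In a union of pairwise disjoint open sets, the connected component of a point is contained in
the member of the family containing that point. -/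
theorem connectedComponentIn_sUnion_subset {X : Type*} [TopologicalSpace X] {F : Set (Set X)}
    (ho : ∀ S ∈ F, IsOpen S) (hd : F.PairwiseDisjoint id) {S : Set X} (hS : S ∈ F) {x : X}
    (hx : x ∈ S) : connectedComponentIn (⋃₀ F) x ⊆ S := by
  refine IsPreconnected.subset_left_of_subset_union (ho S hS)
    (isOpen_sUnion fun T (hT : T ∈ F \ {S}) => ho T hT.1) ?_ ?_
    ⟨x, mem_connectedComponentIn ⟨S, hS, hx⟩, hx⟩ isPreconnected_connectedComponentIn
  · exact disjoint_sUnion_right.2 fun T hT => hd hS hT.1 (Ne.symm hT.2)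
  · refine (connectedComponentIn_subset _ _).trans ?_
    rintro y ⟨T, hT, hy⟩
    by_cases hTS : T = S
    · exact Or.inl (hTS ▸ hy)
    · exact Or.inr ⟨T, ⟨hT, hTS⟩, hy⟩

theorem stmt15 (I : Set ℝ) (hIo : IsOpen I) (hIc : I.OrdConnected)
    (f : ℝ → ℝ) (hf : ContinuousOn f I)
    (h : ∀ c d : ℝ, c < d → Ioo c d ⊆ I →
      ∃ c' d' : ℝ, c ≤ c' ∧ c' < d' ∧ d' ≤ d ∧
        (StrictMonoOn f (Ioo c' d') ∨ StrictAntiOn f (Ioo c' d') ∨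
          ∀ x ∈ Ioo c' d', ∀ y ∈ Ioo c' d', f x = f y)) :
    ∃ U : Set ℝ, U ⊆ I ∧ IsOpen U ∧ I ⊆ closure U ∧
      ∀ x ∈ U, StrictMonoOn f (connectedComponentIn U x) ∨
        StrictAntiOn f (connectedComponentIn U x) ∨
        ∀ y ∈ connectedComponentIn U x, ∀ z ∈ connectedComponentIn U x, f y = f z := by
  let P : Set ℝ → Prop := fun S => StrictMonoOn f S ∨ StrictAntiOn f S ∨
    ∀ y ∈ S, ∀ z ∈ S, f y = f z
  have hP : ∀ {S T : Set ℝ}, S ⊆ T → P T → P S := by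
    rintro S T hST (hT | hT | hT)
    · exact Or.inl (hT.mono hST)
    · exact Or.inr (Or.inl (hT.mono hST))
    · exact Or.inr (Or.inr fun y hy z hz => hT y (hST hy) z (hST hz))
  obtain ⟨F, ⟨hFB, hFd⟩, hmax⟩ :=
    exists_maximal_pairwiseDisjoint {S : Set ℝ | IsOpen S ∧ S ⊆ I ∧ P S}
  refine ⟨⋃₀ F, sUnion_subset fun S hS => (hFB hS).2.1, isOpen_sUnion fun S hS => (hFB hS).1,
    fun x hx => ?_, ?_⟩
  · by_contra hxU
    obtain ⟨a, b, hxab, hab⟩ := mem_nhds_iff_exists_Ioo_subset.1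
      ((hIo.inter isClosed_closure.isOpen_compl).mem_nhds ⟨hx, hxU⟩)
    obtain ⟨c, d, hac, hcd, hdb, hPcd⟩ :=
      h a b (hxab.1.trans hxab.2) fun y hy => (hab hy).1
    have hsub : Ioo c d ⊆ I ∩ (closure (⋃₀ F))ᶜ := (Ioo_subset_Ioo hac hdb).trans hab
    have hmem : Ioo c d ∈ F := by
      refine hmax (y := insert (Ioo c d) F) ⟨insert_subset ⟨isOpen_Ioo, fun y hy => (hsub hy).1,
        hPcd⟩ hFB, hFd.insert fun T hT _ => ?_⟩ (subset_insert _ _) (mem_insert _ _)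
      exact disjoint_left.2 fun y hy hyT => (hsub hy).2 (subset_closure ⟨T, hT, hyT⟩)
    obtain ⟨y, hy⟩ := nonempty_Ioo.2 hcd
    exact (hsub hy).2 (subset_closure ⟨_, hmem, hy⟩)
  · rintro x ⟨S, hS, hxS⟩
    exact hP (connectedComponentIn_sUnion_subset (fun T hT => (hFB hT).1) hFd hS hxS) (hFB hS).2.2
end

section
/- Let I ⊆ ℝ be an open interval and f : I → ℝ be monotone and continuous. For λ, δ > 0 let B_{λ,δ} := {x ∈ I : |f(x) − f(y)| ≤ λ|x − y| for all y ∈ I with x − δ ≤ y < x + δ}. Then each B_{λ,δ} is closed in I, and the complement in I of the union ⋃ B_{λ,δ}, taken over all positive rational λ and δ, has Lebesgue measure zero. -/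
open Set

/-- `B_{λ,δ}`: the set of `x ∈ I` such that `|f(x) - f(y)| ≤ λ|x - y|` for all
`y ∈ I` with `x - δ ≤ y < x + δ`. -/
def LipPartSet (f : ℝ → ℝ) (I : Set ℝ) (lam δ : ℝ) : Set ℝ :=
  {x ∈ I | ∀ y ∈ I, x - δ ≤ y → y < x + δ → |f x - f y| ≤ lam * |x - y|}

open Filter Topology in
/-- A limit in `I` of points of `LipPartSet f I lam δ` belongs to `LipPartSet f I lam δ`. -/
theorem closure_lipPartSet_inter_subset {I : Set ℝ} (hIo : IsOpen I) {f : ℝ → ℝ}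
    (hf : ContinuousOn f I) (lam δ : ℝ) :
    closure (LipPartSet f I lam δ) ∩ I ⊆ LipPartSet f I lam δ := by
  rintro x ⟨hxc, hxI⟩
  refine ⟨hxI, fun y hyI hy₁ hy₂ => ?_⟩
  have : (𝓝[LipPartSet f I lam δ] x).NeBot := mem_closure_iff_nhdsWithin_neBot.1 hxc
  have hid : Tendsto (fun z : ℝ => z) (𝓝[LipPartSet f I lam δ] x) (𝓝 x) := nhdsWithin_le_nhds
  have hty : Tendsto (fun z => y + (z - x)) (𝓝[LipPartSet f I lam δ] x) (𝓝 y) := by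
    simpa using (hid.sub_const x).const_add y
  have hfx := (hf.continuousAt (hIo.mem_nhds hxI)).tendsto.comp hid
  have hfy := (hf.continuousAt (hIo.mem_nhds hyI)).tendsto.comp hty
  refine le_of_tendsto_of_tendsto (hfx.sub hfy).abs ((hid.sub hty).abs.const_mul lam) ?_
  filter_upwards [self_mem_nhdsWithin, hty (hIo.mem_nhds hyI)] with z hz hyz
  exact hz.2 _ hyz (by linarith) (by linarith)

open Filter Topology in
/-- A point of differentiability lies in `LipPartSet f I q r` for some positive rationals. -/
theorem DifferentiableAt.exists_rat_mem_lipPartSet {I : Set ℝ} {f : ℝ → ℝ} {x : ℝ}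
    (h : DifferentiableAt ℝ f x) (hx : x ∈ I) :
    ∃ q : ℚ, 0 < q ∧ ∃ r : ℚ, 0 < r ∧ x ∈ LipPartSet f I q r := by
  obtain ⟨c, hc⟩ := h.isBigO_sub.bound
  obtain ⟨ε, hε, hball⟩ := Metric.eventually_nhds_iff.1 hc
  obtain ⟨q, hq⟩ := exists_rat_gt (max c 0)
  obtain ⟨r, hr₀, hr⟩ := exists_rat_btwn hε
  have hq₀ : (0 : ℝ) < q := (le_max_right c 0).trans_lt hq
  refine ⟨q, by exact_mod_cast hq₀, r, by exact_mod_cast hr₀, hx, fun y _ hy₁ hy₂ => ?_⟩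
  have hyx : Dist.dist y x < ε := by
    rw [Real.dist_eq]
    exact (abs_le.2 ⟨by linarith, by linarith⟩ : |y - x| ≤ r).trans_lt hr
  have hle := hball hyx
  rw [Real.norm_eq_abs, Real.norm_eq_abs] at hle
  rw [abs_sub_comm (f x), abs_sub_comm x]
  exact hle.trans (mul_le_mul_of_nonneg_right ((le_max_left c 0).trans hq.le) (abs_nonneg _))

open MeasureTheory in
/-- A function that is monotone or antitone on an open set is differentiable at almost every
point of it. -/
theorem ae_differentiableAt_of_monotoneOn_or_antitoneOn {I : Set ℝ} (hIo : IsOpen I)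
    {f : ℝ → ℝ} (hm : MonotoneOn f I ∨ AntitoneOn f I) :
    ∀ᵐ x, x ∈ I → DifferentiableAt ℝ f x := by
  rcases hm with hm | hm
  · filter_upwards [hm.ae_differentiableWithinAt_of_mem] with x hx hxI
    exact (hx hxI).differentiableAt (hIo.mem_nhds hxI)
  · filter_upwards [hm.neg.ae_differentiableWithinAt_of_mem] with x hx hxI
    simpa using ((hx hxI).differentiableAt (hIo.mem_nhds hxI)).neg

theorem stmt17 (I : Set ℝ) (hIo : IsOpen I) (hIc : I.OrdConnected)
    (f : ℝ → ℝ) (hf : ContinuousOn f I)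
    (hm : MonotoneOn f I ∨ AntitoneOn f I) :
    (∀ lam δ : ℝ, 0 < lam → 0 < δ →
      ∃ F : Set ℝ, IsClosed F ∧ LipPartSet f I lam δ = F ∩ I) ∧
    MeasureTheory.volume
      (I \ ⋃ (q : ℚ) (_ : 0 < q) (r : ℚ) (_ : 0 < r),
        LipPartSet f I (q : ℝ) (r : ℝ)) = 0 := by
  refine ⟨fun lam δ _ _ => ⟨closure (LipPartSet f I lam δ), isClosed_closure, ?_⟩, ?_⟩
  · exact (subset_inter subset_closure fun x hx => hx.1).antisymm
      (closure_lipPartSet_inter_subset hIo hf lam δ)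
  · refine MeasureTheory.measure_mono_null ?_
      (MeasureTheory.ae_iff.1 (ae_differentiableAt_of_monotoneOn_or_antitoneOn hIo hm))
    rintro x ⟨hxI, hx⟩ hd
    obtain ⟨q, hq, r, hr, hmem⟩ := (hd hxI).exists_rat_mem_lipPartSet hxI
    exact hx (by simp only [mem_iUnion]; exact ⟨q, hq, r, hr, hmem⟩)
end
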